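/- arXiv:1108.4132 — 2 statements merged into one kernel-verified Lean document; each statement's English description precedes it below -/
import Mathlib

section
/- Let q be a prime power and d a positive integer. Define R(q,d) as the total number of cycles of f acting on P^1(F_q), summed over all rational functions f on P^1(F_q) of degree exactly d, divided by the number of rational functions of degree exactly d. If d < q−1, then R(q,d) ≤ (q+1)/(d+2) + (1 + 2/q^2)·Σ_{k=1}^{d+1} (1/k). If d ≥ q−1, then R(q,d) ≤ (1 + 2/q^2)·Σ_{k=1}^{q+1} (1/k). -/
open Polynomial
open scoped Classical

/-- The self-map of `P¹(F) = F ∪ {∞}` (modeled as `Option F`, with `none` = `∞`) induced by the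
rational function `f/g`.  At a finite point `a`: if `g(a) ≠ 0` the value is `f(a)/g(a)`; if
`g(a) = 0` and `f(a) ≠ 0` the value is `∞` (for coprime `(f,g)` the remaining case is junk).
At `∞`: the value is `∞`, the ratio of leading coefficients, or `0`, according to whether
`deg f > deg g`, `deg f = deg g`, or `deg f < deg g`.  In particular a pair `(c, 0)` with
`c ≠ 0` induces the constant map `∞`. -/
noncomputable def ratMap {F : Type*} [Field F] (f g : Polynomial F) : Option F → Option F :=
  fun x =>
    match x with
    | some a =>
        if g.eval a = 0 then (if f.eval a = 0 then some 0 else none)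
        else some (f.eval a / g.eval a)
    | none =>
        if g.degree < f.degree then none
        else if f.degree = g.degree then some (f.leadingCoeff / g.leadingCoeff)
        else some 0

/-- `c` is a cycle of the map `φ`: a nonempty finite set, closed under `φ`, on which `φ` acts
transitively (equivalently, an orbit of periodic points `α₁ → α₂ → ⋯ → α_k → α₁`). -/
def IsCycleSet {S : Type*} (φ : S → S) (c : Finset S) : Prop :=
  c.Nonempty ∧ (∀ x ∈ c, φ x ∈ c) ∧ ∀ x ∈ c, ∀ y ∈ c, ∃ j : ℕ, φ^[j] x = y

/-- Two pairs of polynomials differ by a nonzero scalar. -/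
def ScaleRel {F : Type*} [Field F] (p₁ p₂ : Polynomial F × Polynomial F) : Prop :=
  ∃ c : F, c ≠ 0 ∧ p₂.1 = c • p₁.1 ∧ p₂.2 = c • p₁.2

/-- The rational functions on `P¹(F)` of degree exactly `d`: coprime pairs of polynomials
`(f, g)` with `max (deg f) (deg g) = d`, up to a common nonzero scalar.  (This includes all
constant maps, of degree `0`, in particular the constant map `∞`, class of `(1, 0)`.) -/
def RatFn (F : Type) [Field F] (d : ℕ) : Type :=
  Quot (fun p₁ p₂ : {p : Polynomial F × Polynomial F //
      IsCoprime p.1 p.2 ∧ max p.1.natDegree p.2.natDegree = d} => ScaleRel p₁.1 p₂.1)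

/-- The rational functions on `P¹(F)` of degree at most `d`: coprime pairs of polynomials
`(f, g)` with `max (deg f) (deg g) ≤ d`, up to a common nonzero scalar. -/
def RatFnLe (F : Type) [Field F] (d : ℕ) : Type :=
  Quot (fun p₁ p₂ : {p : Polynomial F × Polynomial F //
      IsCoprime p.1 p.2 ∧ max p.1.natDegree p.2.natDegree ≤ d} => ScaleRel p₁.1 p₂.1)

section PairCounting

variable {F : Type} [Field F]

/-- Pairs of polynomials of degree less than `n`. -/
def pairsDegreeLT (F : Type) [Field F] (n : ℕ) : Set (F[X] × F[X]) :=
  {p | p.1 ∈ degreeLT F n ∧ p.2 ∈ degreeLT F n}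

/-- Nonzero pairs of polynomials with maximal degree exactly `n`. -/
def pairsDegreeEq (F : Type) [Field F] (n : ℕ) : Set (F[X] × F[X]) :=
  pairsDegreeLT F (n + 1) \ pairsDegreeLT F n

/-- Coprime pairs of polynomials with maximal degree exactly `d`. -/
abbrev CoprimePair (F : Type) [Field F] (d : ℕ) : Type :=
  {p : F[X] × F[X] // IsCoprime p.1 p.2 ∧ max p.1.natDegree p.2.natDegree = d}

theorem natCard_degreeLT [Finite F] (n : ℕ) : Nat.card (degreeLT F n) = Nat.card F ^ n := by
  rw [Nat.card_congr (degreeLTEquiv F n).toEquiv, Nat.card_fun, Nat.card_fin]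

instance finite_degreeLT [Finite F] (n : ℕ) : Finite (degreeLT F n) :=
  Finite.of_equiv _ (degreeLTEquiv F n).toEquiv.symm

theorem pairsDegreeLT_eq_prod (n : ℕ) :
    pairsDegreeLT F n = (degreeLT F n : Set F[X]) ×ˢ (degreeLT F n : Set F[X]) := by
  ext p
  simp [pairsDegreeLT]

theorem finite_pairsDegreeLT [Finite F] (n : ℕ) : (pairsDegreeLT F n).Finite := by
  rw [pairsDegreeLT_eq_prod]
  have h : (degreeLT F n : Set F[X]).Finite := Set.finite_coe_iff.1 (finite_degreeLT n)
  exact h.prod h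

theorem ncard_pairsDegreeLT [Finite F] (n : ℕ) :
    (pairsDegreeLT F n).ncard = Nat.card F ^ (2 * n) := by
  have h : (degreeLT F n : Set F[X]).ncard = Nat.card F ^ n := natCard_degreeLT n
  rw [pairsDegreeLT_eq_prod, Set.ncard_prod, h]
  ring

theorem ncard_pairsDegreeEq_add [Finite F] (n : ℕ) :
    (pairsDegreeEq F n).ncard + Nat.card F ^ (2 * n) = Nat.card F ^ (2 * n + 2) := by
  rw [pairsDegreeEq, ← ncard_pairsDegreeLT (F := F) n, Set.ncard_sdiff_add_ncard_of_subset _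
    (finite_pairsDegreeLT _), ncard_pairsDegreeLT]
  · rfl
  · exact fun p hp => ⟨degreeLT_mono (Nat.le_succ n) hp.1, degreeLT_mono (Nat.le_succ n) hp.2⟩

theorem mem_pairsDegreeEq_iff {d : ℕ} {p : F[X] × F[X]} (hp : IsCoprime p.1 p.2) :
    p ∈ pairsDegreeEq F d ↔ max p.1.natDegree p.2.natDegree = d := by
  have key : ∀ f : F[X], ∀ n : ℕ, f ∈ degreeLT F (n + 1) ↔ f.natDegree ≤ n := by
    intro f n
    rw [degreeLT_succ_eq_degreeLE, mem_degreeLE, natDegree_le_iff_degree_le]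
  have key0 : ∀ f : F[X], f ∈ degreeLT F 0 ↔ f = 0 := by
    intro f
    simp [mem_degreeLT]
  obtain _ | d := d
  · simp only [pairsDegreeEq, pairsDegreeLT, Set.mem_sdiff, Set.mem_ofPred_eq, key, key0]
    constructor
    · rintro ⟨⟨h1, h2⟩, -⟩
      omega
    · intro h
      refine ⟨by omega, ?_⟩
      rintro ⟨h1, h2⟩
      rw [h1, h2] at hp
      exact not_isCoprime_zero_zero hp
  · simp only [pairsDegreeEq, pairsDegreeLT, Set.mem_sdiff, Set.mem_ofPred_eq, key]
    omega

instance finite_coprimePair [Finite F] (d : ℕ) : Finite (CoprimePair F d) := by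
  have : Finite ↥(pairsDegreeEq F d) :=
    ((finite_pairsDegreeLT (d + 1)).subset Set.sdiff_subset).to_subtype
  exact Finite.of_injective
    (fun p : CoprimePair F d =>
      (⟨p.1, (mem_pairsDegreeEq_iff p.2.1).2 p.2.2⟩ : ↥(pairsDegreeEq F d)))
    (fun p p' h => Subtype.ext (congrArg (fun x => x.1) h))

theorem mul_mem_degreeLT_iff {h f : F[X]} (hh : h.Monic) (m : ℕ) :
    h * f ∈ degreeLT F (m + h.natDegree) ↔ f ∈ degreeLT F m := by
  by_cases hf : f = 0
  · simp [hf]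
  · have h1 : h * f ≠ 0 := mul_ne_zero hh.ne_zero hf
    rw [mem_degreeLT, mem_degreeLT, degree_eq_natDegree h1, degree_eq_natDegree hf,
      natDegree_mul hh.ne_zero hf]
    norm_cast
    omega

theorem mul_mem_pairsDegreeEq_iff {h f g : F[X]} (hh : h.Monic) (m : ℕ) :
    (h * f, h * g) ∈ pairsDegreeEq F (m + h.natDegree) ↔ (f, g) ∈ pairsDegreeEq F m := by
  simp only [pairsDegreeEq, pairsDegreeLT, Set.mem_sdiff, Set.mem_ofPred_eq,
    mul_mem_degreeLT_iff hh]
  rw [show m + h.natDegree + 1 = m + 1 + h.natDegree by ring]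
  simp only [mul_mem_degreeLT_iff hh]

theorem natDegree_le_of_mul_mem_pairsDegreeEq {h f g : F[X]} {d : ℕ} (hh : h.Monic)
    (hm : (h * f, h * g) ∈ pairsDegreeEq F d) : h.natDegree ≤ d := by
  obtain ⟨⟨h1, h2⟩, h3⟩ := hm
  by_contra! hlt
  have key : ∀ u : F[X], h * u ∈ degreeLT F (d + 1) → h * u = 0 := by
    intro u hu
    have := degreeLT_mono (show d + 1 ≤ 0 + h.natDegree by omega) hu
    rw [mul_mem_degreeLT_iff hh, mem_degreeLT] at this
    simp at this
    simp [this]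
  apply h3
  simp only [pairsDegreeLT, Set.mem_ofPred_eq]
  simp only at h1 h2
  rw [key f h1, key g h2]
  simp

theorem exists_monic_mul_isCoprime {f g : F[X]} (h : (f, g) ≠ 0) :
    ∃ c f₀ g₀ : F[X], c.Monic ∧ IsCoprime f₀ g₀ ∧ f = c * f₀ ∧ g = c * g₀ := by
  have h0 : EuclideanDomain.gcd f g ≠ 0 := by
    rw [Ne, EuclideanDomain.gcd_eq_zero_iff]
    rintro ⟨rfl, rfl⟩
    exact h rfl
  obtain ⟨a, ha⟩ := EuclideanDomain.gcd_dvd_left f g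
  obtain ⟨b, hb⟩ := EuclideanDomain.gcd_dvd_right f g
  have hco : IsCoprime a b := by
    have hbez := EuclideanDomain.gcd_eq_gcd_ab f g
    refine ⟨EuclideanDomain.gcdA f g, EuclideanDomain.gcdB f g, mul_left_cancel₀ h0 ?_⟩
    calc _ = (EuclideanDomain.gcd f g * a) * EuclideanDomain.gcdA f g
          + (EuclideanDomain.gcd f g * b) * EuclideanDomain.gcdB f g := by ring
      _ = EuclideanDomain.gcd f g * 1 := by rw [← ha, ← hb, ← hbez, mul_one]
  set c := EuclideanDomain.gcd f g
  have hl : c.leadingCoeff ≠ 0 := leadingCoeff_ne_zero.2 h0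
  have hu : IsUnit (C c.leadingCoeff) := isUnit_C.2 hl.isUnit
  have hCC : C c.leadingCoeff⁻¹ * C c.leadingCoeff = 1 := by
    rw [← C_mul, inv_mul_cancel₀ hl, C_1]
  refine ⟨c * C c.leadingCoeff⁻¹, C c.leadingCoeff * a, C c.leadingCoeff * b,
    monic_mul_leadingCoeff_inv h0, ?_, ?_, ?_⟩
  · exact (isCoprime_mul_unit_left hu a b).2 hco
  · rw [mul_assoc, ← mul_assoc (C _) (C _), hCC, one_mul, ha]
  · rw [mul_assoc, ← mul_assoc (C _) (C _), hCC, one_mul, hb]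

theorem monic_mul_isCoprime_unique {c f g c' f' g' : F[X]} (hc : c.Monic) (hc' : c'.Monic)
    (h : IsCoprime f g) (h' : IsCoprime f' g') (hf : c * f = c' * f') (hg : c * g = c' * g') :
    c = c' ∧ f = f' ∧ g = g' := by
  have hcc : c = c' := by
    refine eq_of_monic_of_associated hc hc' (associated_of_dvd_dvd ?_ ?_)
    · obtain ⟨u, v, huv⟩ := h'
      refine ⟨u * f + v * g, ?_⟩
      linear_combination (-c') * huv - u * hf - v * hg
    · obtain ⟨u, v, huv⟩ := h
      refine ⟨u * f' + v * g', ?_⟩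
      linear_combination (-c) * huv + u * hf + v * hg
  subst hcc
  exact ⟨rfl, mul_left_cancel₀ hc.ne_zero hf, mul_left_cancel₀ hc.ne_zero hg⟩

theorem monic_divX {h : F[X]} (hh : h.Monic) (hd : h.natDegree ≠ 0) : h.divX.Monic := by
  rw [Monic, leadingCoeff, natDegree_divX_eq_natDegree_tsub_one, coeff_divX,
    Nat.sub_add_cancel (Nat.pos_of_ne_zero hd)]
  exact hh

theorem pairsDegreeEq_ne_zero {n : ℕ} {p : F[X] × F[X]} (hp : p ∈ pairsDegreeEq F n) : p ≠ 0 := by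
  rintro rfl
  exact hp.2 ⟨Submodule.zero_mem _, Submodule.zero_mem _⟩

/-- Replacing the gcd `h` of a non-coprime pair by `h.divX` and remembering `h.coeff 0` embeds the
non-coprime pairs of degree `n + 1` into `F` times the pairs of degree `n`. -/
theorem ncard_not_isCoprime_le [Finite F] (n : ℕ) :
    {p ∈ pairsDegreeEq F (n + 1) | ¬ IsCoprime p.1 p.2}.ncard
      ≤ Nat.card F * (pairsDegreeEq F n).ncard := by
  have hex : ∀ p : ↥(pairsDegreeEq F (n + 1)), ∃ t : F[X] × F[X] × F[X],
      t.1.Monic ∧ IsCoprime t.2.1 t.2.2 ∧ p.1.1 = t.1 * t.2.1 ∧ p.1.2 = t.1 * t.2.2 := by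
    rintro ⟨⟨f, g⟩, hp⟩
    obtain ⟨c, f₀, g₀, h⟩ := exists_monic_mul_isCoprime (pairsDegreeEq_ne_zero hp)
    exact ⟨(c, f₀, g₀), h⟩
  choose t ht1 ht2 ht3 ht4 using hex
  have hfin : (pairsDegreeEq F n).Finite := (finite_pairsDegreeLT (n + 1)).subset Set.sdiff_subset
  have : Finite ↥(pairsDegreeEq F n) := hfin.to_subtype
  have hdeg : ∀ p : ↥(pairsDegreeEq F (n + 1)), ¬ IsCoprime p.1.1 p.1.2 →
      (t p).1.natDegree ≠ 0 := by
    intro p hp h0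
    apply hp
    have h1 : (t p).1 = 1 := (ht1 p).natDegree_eq_zero.1 h0
    rw [ht3, ht4, h1, one_mul, one_mul]
    exact ht2 p
  have hmem : ∀ p : ↥(pairsDegreeEq F (n + 1)), ¬ IsCoprime p.1.1 p.1.2 →
      ((t p).1.divX * (t p).2.1, (t p).1.divX * (t p).2.2) ∈ pairsDegreeEq F n := by
    intro p hp
    have h0 := hdeg p hp
    have h1 : ((t p).1 * (t p).2.1, (t p).1 * (t p).2.2) ∈ pairsDegreeEq F (n + 1) := by
      rw [← ht3, ← ht4]
      exact p.2
    have h2 := natDegree_le_of_mul_mem_pairsDegreeEq (ht1 p) h1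
    obtain ⟨m, hm⟩ := Nat.exists_eq_add_of_le' h2
    have h3 : n = m + (t p).1.divX.natDegree := by
      rw [natDegree_divX_eq_natDegree_tsub_one]
      omega
    rw [hm, mul_mem_pairsDegreeEq_iff (ht1 p)] at h1
    rw [h3, mul_mem_pairsDegreeEq_iff (monic_divX (ht1 p) h0)]
    exact h1
  have hcard : Nat.card (F × ↥(pairsDegreeEq F n)) = Nat.card F * (pairsDegreeEq F n).ncard := by
    rw [Nat.card_prod]
    rfl
  rw [← hcard]
  refine Nat.card_le_card_of_injective
    (fun p : {p ∈ pairsDegreeEq F (n + 1) | ¬ IsCoprime p.1 p.2} =>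
      ((t ⟨p.1, p.2.1⟩).1.coeff 0, (⟨_, hmem ⟨p.1, p.2.1⟩ p.2.2⟩ : ↥(pairsDegreeEq F n)))) ?_
  rintro ⟨p, hp1, hp2⟩ ⟨p', hp1', hp2'⟩ heq
  simp only [Prod.mk.injEq, Subtype.mk.injEq] at heq
  obtain ⟨hc, hf, hg⟩ := heq
  obtain ⟨h1, h2, h3⟩ := monic_mul_isCoprime_unique
    (monic_divX (ht1 _) (hdeg ⟨p, hp1⟩ hp2)) (monic_divX (ht1 _) (hdeg ⟨p', hp1'⟩ hp2'))
    (ht2 _) (ht2 _) hf hg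
  have h4 : (t ⟨p, hp1⟩).1 = (t ⟨p', hp1'⟩).1 := by
    rw [← divX_mul_X_add (t ⟨p, hp1⟩).1, ← divX_mul_X_add (t ⟨p', hp1'⟩).1, h1, hc]
  apply Subtype.ext
  apply Prod.ext
  · exact (ht3 ⟨p, hp1⟩).trans (by rw [h4, h2, ← ht3])
  · exact (ht4 ⟨p, hp1⟩).trans (by rw [h4, h3, ← ht4])

theorem natCard_coprimePair_ge [Finite F] (n : ℕ) :
    ((Nat.card F : ℝ) + 1) * ((Nat.card F : ℝ) - 1) ^ 2 * (Nat.card F : ℝ) ^ (2 * n + 1)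
      ≤ Nat.card (CoprimePair F (n + 1)) := by
  have hfin : (pairsDegreeEq F (n + 1)).Finite :=
    (finite_pairsDegreeLT (n + 1 + 1)).subset Set.sdiff_subset
  have h1 : Nat.card (CoprimePair F (n + 1))
      = {p ∈ pairsDegreeEq F (n + 1) | IsCoprime p.1 p.2}.ncard := by
    refine Nat.card_congr (Equiv.subtypeEquivRight fun p => ?_)
    constructor
    · rintro ⟨h1, h2⟩
      exact ⟨(mem_pairsDegreeEq_iff h1).2 h2, h1⟩
    · rintro ⟨h1, h2⟩
      exact ⟨h2, (mem_pairsDegreeEq_iff h2).1 h1⟩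
  have h2 : (pairsDegreeEq F (n + 1)).ncard
      = {p ∈ pairsDegreeEq F (n + 1) | IsCoprime p.1 p.2}.ncard
        + {p ∈ pairsDegreeEq F (n + 1) | ¬ IsCoprime p.1 p.2}.ncard := by
    rw [← Set.ncard_union_eq _ (hfin.subset (Set.sep_subset _ _))
      (hfin.subset (Set.sep_subset _ _))]
    · congr 1
      ext p
      simp only [Set.mem_union, Set.mem_ofPred_eq]
      tauto
    · rw [Set.disjoint_left]
      rintro p ⟨-, h⟩ ⟨-, h'⟩
      exact h' h
  have h3 := ncard_not_isCoprime_le (F := F) n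
  have h4 := ncard_pairsDegreeEq_add (F := F) n
  have h5 := ncard_pairsDegreeEq_add (F := F) (n + 1)
  rw [h1]
  rw [h2] at h5
  rify at h3 h4 h5
  have h6 : ((pairsDegreeEq F n).ncard : ℝ)
      = (Nat.card F : ℝ) ^ (2 * n + 2) - (Nat.card F : ℝ) ^ (2 * n) := by linarith
  rw [h6] at h3
  have h7 : ((Nat.card F : ℝ) + 1) * ((Nat.card F : ℝ) - 1) ^ 2 * (Nat.card F : ℝ) ^ (2 * n + 1)
      = (Nat.card F : ℝ) ^ (2 * (n + 1) + 2) - (Nat.card F : ℝ) ^ (2 * (n + 1))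
      - Nat.card F * ((Nat.card F : ℝ) ^ (2 * n + 2) - (Nat.card F : ℝ) ^ (2 * n)) := by ring
  rw [h7]
  linarith

end PairCounting

section Interpolation

variable {F : Type} [Field F]

/-- Evaluation of polynomials of degree at most `d`, regarded as binary forms of degree `d`, at a
point of the projective line. -/
noncomputable def evalForm (d : ℕ) : Option F → F[X] →ₗ[F] F
  | none => lcoeff F d
  | some a => leval a

@[simp] theorem evalForm_none (d : ℕ) (p : F[X]) : evalForm d none p = p.coeff d := rfl

@[simp] theorem evalForm_some (d : ℕ) (a : F) (p : F[X]) :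
    evalForm d (some a) p = p.eval a := rfl

/-- The point of the projective line with given homogeneous coordinates. -/
noncomputable def projPoint (w : F × F) : Option F :=
  if w.2 = 0 then none else some (w.1 / w.2)

theorem projPoint_mk (u v : F) : projPoint (u, v) = if v = 0 then none else some (u / v) := rfl

/-- The homogeneous coordinates of the value of `f / g` at `x`. -/
noncomputable def evalPair (d : ℕ) (p : F[X] × F[X]) (x : Option F) : F × F :=
  (evalForm d x p.1, evalForm d x p.2)

theorem evalPair_ne_zero {d : ℕ} (hd : 0 < d) (p : CoprimePair F d) (x : Option F) :
    evalPair d p.1 x ≠ 0 := by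
  obtain ⟨⟨f, g⟩, hco, hmax⟩ := p
  intro h
  simp only [evalPair, Prod.mk_eq_zero] at h
  simp only at hco hmax
  obtain ⟨h1, h2⟩ := h
  cases x with
  | none =>
    rw [evalForm_none] at h1 h2
    rcases max_choice f.natDegree g.natDegree with h | h
    · rw [hmax] at h
      rw [h] at h1 hd
      have : f = 0 := leadingCoeff_eq_zero.1 h1
      simp [this] at hd
    · rw [hmax] at h
      rw [h] at h2 hd
      have : g = 0 := leadingCoeff_eq_zero.1 h2
      simp [this] at hd
  | some a =>
    obtain ⟨u, v, huv⟩ := hco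
    have := congrArg (eval a) huv
    rw [evalForm_some] at h1 h2
    simp [h1, h2] at this

theorem ratMap_eq_projPoint {d : ℕ} (hd : 0 < d) (p : CoprimePair F d) (x : Option F) :
    ratMap p.1.1 p.1.2 x = projPoint (evalPair d p.1 x) := by
  have hne := evalPair_ne_zero hd p x
  obtain ⟨⟨f, g⟩, hco, hmax⟩ := p
  simp only at hmax
  cases x with
  | none =>
    change _ = projPoint (f.coeff d, g.coeff d)
    simp only [ratMap, projPoint_mk]
    by_cases h1 : g.degree < f.degree
    · have hlt : g.natDegree ≤ f.natDegree := natDegree_le_natDegree h1.le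
      have hf : f.natDegree = d := by omega
      have hg : g.coeff d = 0 := by
        apply coeff_eq_zero_of_degree_lt
        rw [← hf]
        exact h1.trans_le degree_le_natDegree
      rw [if_pos h1, if_pos hg]
    · rw [if_neg h1]
      have hle : f.degree ≤ g.degree := not_lt.1 h1
      have hlt : f.natDegree ≤ g.natDegree := natDegree_le_natDegree hle
      have hg : g.natDegree = d := by omega
      have hg0 : g ≠ 0 := by
        rintro rfl
        simp at hg
        omega
      have hgd : g.coeff d ≠ 0 := by
        rw [← hg]
        exact leadingCoeff_ne_zero.2 hg0
      rw [if_neg hgd]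
      by_cases h2 : f.degree = g.degree
      · rw [if_pos h2, leadingCoeff, leadingCoeff, natDegree_eq_of_degree_eq h2, hg]
      · rw [if_neg h2]
        have hf : f.coeff d = 0 := by
          apply coeff_eq_zero_of_degree_lt
          rw [← hg, ← degree_eq_natDegree hg0]
          exact lt_of_le_of_ne hle h2
        rw [hf, zero_div]
  | some a =>
    change _ = projPoint (f.eval a, g.eval a)
    simp only [ratMap, projPoint_mk]
    simp only [evalPair, evalForm_some, Ne, Prod.mk_eq_zero, not_and] at hne
    by_cases h : g.eval a = 0
    · rw [if_pos h, if_pos h, if_neg fun hf => hne hf h]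
    · rw [if_neg h, if_neg h]

theorem natCard_projPoint_fiber_le [Finite F] (b : Option F) :
    Nat.card {w : F × F // w ≠ 0 ∧ projPoint w = b} ≤ Nat.card F - 1 := by
  rw [← Nat.card_units]
  cases b with
  | none =>
    have key : ∀ w : {w : F × F // w ≠ 0 ∧ projPoint w = none}, w.1.2 = 0 := by
      rintro ⟨w, h1, h2⟩
      by_contra h
      simp [projPoint, h] at h2
    refine Nat.card_le_card_of_injective (fun w => Units.mk0 w.1.1 ?_) ?_
    · intro h
      exact w.2.1 (Prod.ext h (key w))
    · intro w w' h
      have h' := congrArg Units.val h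
      exact Subtype.ext (Prod.ext h' ((key w).trans (key w').symm))
  | some c =>
    have key : ∀ w : {w : F × F // w ≠ 0 ∧ projPoint w = some c},
        w.1.2 ≠ 0 ∧ w.1.1 = c * w.1.2 := by
      rintro ⟨w, h1, h2⟩
      by_cases h : w.2 = 0
      · simp [projPoint, h] at h2
      · simp only [projPoint, h, if_false, Option.some.injEq] at h2
        exact ⟨h, (div_eq_iff h).1 h2⟩
    refine Nat.card_le_card_of_injective (fun w => Units.mk0 w.1.2 (key w).1) ?_
    intro w w' h
    have h' : w.1.2 = w'.1.2 := congrArg Units.val h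
    exact Subtype.ext (Prod.ext (by rw [(key w).2, (key w').2, h']) h')

theorem exists_evalForm_ne_zero {d : ℕ} (x : Option F) (A : Finset (Option F)) (hx : x ∉ A)
    (hA : A.card ≤ d) :
    ∃ p ∈ degreeLT F (d + 1), evalForm d x p ≠ 0 ∧ ∀ y ∈ A, evalForm d y p = 0 := by
  set s := Finset.eraseNone A with hs
  set m : F[X] := ∏ a ∈ s, (X - C a) with hm
  have hmm : m.Monic := monic_prod_of_monic _ _ fun a _ => monic_X_sub_C a
  have hmd : m.natDegree = s.card := by
    rw [hm, natDegree_prod_of_monic _ _ fun a _ => monic_X_sub_C a]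
    simp
  have hroot : ∀ a : F, m.eval a = 0 ↔ a ∈ s := by
    intro a
    rw [hm, eval_prod, Finset.prod_eq_zero_iff]
    simp only [eval_sub, eval_X, eval_C, sub_eq_zero]
    simp
  have hsA : s.card ≤ A.card := by
    rw [← Finset.card_map Function.Embedding.some, hs, Finset.map_some_eraseNone]
    exact Finset.card_erase_le
  have hle : ∀ f : F[X], f ∈ degreeLT F (d + 1) ↔ f.natDegree ≤ d := by
    intro f
    rw [degreeLT_succ_eq_degreeLE, mem_degreeLE, natDegree_le_iff_degree_le]
  cases x with
  | none =>
    have hmon : (X ^ (d - s.card) * m).Monic := (monic_X_pow _).mul hmm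
    have hdeg : (X ^ (d - s.card) * m).natDegree = d := by
      rw [(monic_X_pow _).natDegree_mul hmm, natDegree_X_pow, hmd]
      omega
    refine ⟨X ^ (d - s.card) * m, (hle _).2 hdeg.le, ?_, ?_⟩
    · have : (X ^ (d - s.card) * m).coeff d = 1 := by
        rw [← hmon.coeff_natDegree, hdeg]
      rw [evalForm_none, this]
      exact one_ne_zero
    · intro y hy
      cases y with
      | none => exact absurd hy hx
      | some a =>
        rw [evalForm_some, eval_mul, (hroot a).2 (Finset.mem_eraseNone.2 hy), mul_zero]
  | some b =>
    refine ⟨m, (hle _).2 (by omega), ?_, ?_⟩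
    · rw [evalForm_some, Ne, hroot, hs, Finset.mem_eraseNone]
      exact hx
    · intro y hy
      cases y with
      | none =>
        rw [evalForm_none]
        apply coeff_eq_zero_of_natDegree_lt
        have : s.card < A.card := by
          rw [← Finset.card_map Function.Embedding.some, hs, Finset.map_some_eraseNone]
          exact Finset.card_erase_lt_of_mem hy
        omega
      | some a => exact (hroot a).2 (Finset.mem_eraseNone.2 hy)

/-- Simultaneous evaluation of forms of degree `d` at several points. -/
noncomputable def evalForms (d : ℕ) {j : ℕ} (α : Fin j ↪ Option F) :
    degreeLT F (d + 1) →ₗ[F] (Fin j → F) :=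
  LinearMap.pi fun i => (evalForm d (α i)).comp (degreeLT F (d + 1)).subtype

theorem evalForms_surjective {d j : ℕ} (hj : j ≤ d + 1) (α : Fin j ↪ Option F) :
    Function.Surjective (evalForms d α) := by
  have hex : ∀ i, ∃ p : degreeLT F (d + 1),
      evalForms d α p i ≠ 0 ∧ ∀ i' ≠ i, evalForms d α p i' = 0 := by
    intro i
    obtain ⟨p, hp, h1, h2⟩ := exists_evalForm_ne_zero (d := d) (α i)
      ((Finset.univ.erase i).map α) (by simp) (by simp; omega)
    refine ⟨⟨p, hp⟩, h1, fun i' hi' => h2 _ ?_⟩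
    simpa using hi'
  choose p hp hp' using hex
  intro v
  refine ⟨∑ i, (v i / evalForms d α (p i) i) • p i, ?_⟩
  ext i
  rw [map_sum, Finset.sum_apply, Finset.sum_eq_single i]
  · rw [map_smul, Pi.smul_apply, smul_eq_mul, div_mul_cancel₀ _ (hp i)]
  · intro i' _ hi'
    rw [map_smul, Pi.smul_apply, hp' i' i hi'.symm, smul_zero]
  · simp

theorem natCard_ker_evalForms [Finite F] {d j : ℕ} (hj : j ≤ d + 1) (α : Fin j ↪ Option F) :
    Nat.card (LinearMap.ker (evalForms d α)) = Nat.card F ^ (d + 1 - j) := by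
  have : Module.Finite F (degreeLT F (d + 1)) :=
    Module.Finite.equiv (degreeLTEquiv F (d + 1)).symm
  rw [Module.natCard_eq_pow_finrank (K := F)]
  congr 1
  have h := LinearMap.finrank_range_add_finrank_ker (evalForms d α)
  rw [LinearMap.range_eq_top.2 (evalForms_surjective hj α), finrank_top,
    (degreeLTEquiv F (d + 1)).finrank_eq] at h
  simp only [Module.finrank_fin_fun] at h
  omega

theorem natCard_coprimePair_interpolation_le [Finite F] {d j : ℕ} (hd : 0 < d) (hj : j ≤ d + 1)
    (α : Fin j ↪ Option F) (β : Fin j → Option F) :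
    Nat.card {p : CoprimePair F d // ∀ i, ratMap p.1.1 p.1.2 (α i) = β i}
      ≤ (Nat.card F - 1) ^ j * Nat.card F ^ (2 * (d + 1 - j)) := by
  let K : Submodule F (degreeLT F (d + 1)) := LinearMap.ker (evalForms d α)
  obtain ⟨π, hπ⟩ := LinearMap.exists_leftInverse_of_injective (K := F) (V := K)
    (V' := degreeLT F (d + 1)) K.subtype K.ker_subtype
  have hfinK : Finite K := Finite.of_injective K.subtype K.injective_subtype
  have hmem : ∀ p : CoprimePair F d, p.1.1 ∈ degreeLT F (d + 1) ∧ p.1.2 ∈ degreeLT F (d + 1) :=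
    fun p => ((mem_pairsDegreeEq_iff p.2.1).2 p.2.2).1
  have hinj : ∀ f g : degreeLT F (d + 1), (∀ i, evalForm d (α i) f.1 = evalForm d (α i) g.1) →
      π f = π g → f = g := by
    intro f g h1 h2
    have h3 : f - g ∈ K := by
      rw [LinearMap.mem_ker, map_sub, sub_eq_zero]
      exact funext h1
    have h4 := LinearMap.congr_fun hπ ⟨f - g, h3⟩
    have h5 : π (f - g) = 0 := by rw [map_sub, h2, sub_self]
    have h6 : (0 : K) = ⟨f - g, h3⟩ := h5.symm.trans h4
    exact sub_eq_zero.1 (congrArg Subtype.val h6).symm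
  have hcard : Nat.card ((∀ i, {w : F × F // w ≠ 0 ∧ projPoint w = β i}) × K × K)
      ≤ (Nat.card F - 1) ^ j * Nat.card F ^ (2 * (d + 1 - j)) := by
    rw [Nat.card_prod, Nat.card_prod, natCard_ker_evalForms hj, ← pow_add, ← two_mul, Nat.card_pi]
    gcongr
    calc _ ≤ ∏ _i : Fin j, (Nat.card F - 1) :=
          Finset.prod_le_prod' fun i _ => natCard_projPoint_fiber_le (β i)
      _ = _ := by simp
  refine le_trans (Nat.card_le_card_of_injective (fun p =>
    ((fun i => ⟨evalPair d p.1.1 (α i), evalPair_ne_zero hd p.1 _,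
      (ratMap_eq_projPoint hd p.1 _).symm.trans (p.2 i)⟩),
      π ⟨p.1.1.1, (hmem p.1).1⟩, π ⟨p.1.1.2, (hmem p.1).2⟩)) ?_) hcard
  intro p p' h
  simp only [Prod.mk.injEq] at h
  obtain ⟨h1, h2, h3⟩ := h
  have h4 : ∀ i, evalPair d p.1.1 (α i) = evalPair d p'.1.1 (α i) :=
    fun i => congrArg Subtype.val (congrFun h1 i)
  apply Subtype.ext
  apply Subtype.ext
  apply Prod.ext
  · exact congrArg Subtype.val (hinj ⟨p.1.1.1, (hmem p.1).1⟩ ⟨p'.1.1.1, (hmem p'.1).1⟩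
    (fun i => congrArg Prod.fst (h4 i)) h2)
  · exact congrArg Subtype.val (hinj ⟨p.1.1.2, (hmem p.1).2⟩ ⟨p'.1.1.2, (hmem p'.1).2⟩
    (fun i => congrArg Prod.snd (h4 i)) h3)

/-- Post-composition with a Möbius transformation sending `b` to `∞`. -/
theorem natCard_coprimePair_value [Finite F] {d : ℕ} (hd : 0 < d) (a b : Option F) :
    Nat.card {p : CoprimePair F d // ratMap p.1.1 p.1.2 a = b}
      = Nat.card {p : CoprimePair F d // ratMap p.1.1 p.1.2 a = none} := by
  cases b with
  | none => rfl
  | some c =>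
    have hpp : ∀ w : F × F, w ≠ 0 → (projPoint w = some c ↔ projPoint (w.2, w.1 - c * w.2) = none)
        := by
      rintro ⟨u, v⟩ hw
      simp only [projPoint]
      by_cases hv : v = 0
      · have hu : u ≠ 0 := fun hu => hw (by simp [hu, hv])
        simp [hv, hu]
      · simp [hv, div_eq_iff hv, sub_eq_zero]
    have hmax : ∀ f g : F[X], max g.natDegree (f - C c * g).natDegree
        = max f.natDegree g.natDegree := by
      intro f g
      have h1 : (C c * g).natDegree ≤ g.natDegree := natDegree_C_mul_le c g
      have h2 := natDegree_sub_le f (C c * g)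
      have h3 : f.natDegree ≤ max (f - C c * g).natDegree (C c * g).natDegree := by
        conv_lhs => rw [← sub_add_cancel f (C c * g)]
        exact natDegree_add_le _ _
      omega
    have hco : ∀ f g : F[X], IsCoprime g (f - C c * g) ↔ IsCoprime f g := by
      intro f g
      rw [isCoprime_comm, sub_eq_add_neg, ← neg_mul, IsCoprime.add_mul_right_left_iff]
    let e : CoprimePair F d ≃ CoprimePair F d :=
      { toFun := fun p => ⟨(p.1.2, p.1.1 - C c * p.1.2), (hco _ _).2 p.2.1,
          (hmax _ _).trans p.2.2⟩
        invFun := fun p => ⟨(p.1.2 + C c * p.1.1, p.1.1),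
          (hco _ _).1 (by simpa using p.2.1), (hmax _ _).symm.trans (by simpa using p.2.2)⟩
        left_inv := fun p => by simp
        right_inv := fun p => by simp }
    refine Nat.card_congr (Equiv.subtypeEquiv e fun p => ?_)
    rw [ratMap_eq_projPoint hd, ratMap_eq_projPoint hd, hpp _ (evalPair_ne_zero hd p a)]
    have : evalPair d (e p).1 a
        = ((evalPair d p.1 a).2, (evalPair d p.1 a).1 - c * (evalPair d p.1 a).2) := by
      simp [e, evalPair, ← smul_eq_C_mul]
    rw [this]

theorem natCard_coprimePair_fixed [Finite F] {d : ℕ} (hd : 0 < d) (a b : Option F) :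
    (Nat.card F + 1) * Nat.card {p : CoprimePair F d // ratMap p.1.1 p.1.2 a = b}
      = Nat.card (CoprimePair F d) := by
  have : Fintype F := Fintype.ofFinite F
  rw [← Nat.card_congr (Equiv.sigmaFiberEquiv
    fun p : CoprimePair F d => ratMap p.1.1 p.1.2 a), Nat.card_sigma]
  simp only [natCard_coprimePair_value hd a]
  simp

end Interpolation

section Cycles

variable {S : Type*} {φ : S → S} {c c' : Finset S} {x : S}

theorem IsCycleSet.mem_periodicPts (hc : IsCycleSet φ c) (hx : x ∈ c) :
    x ∈ Function.periodicPts φ := by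
  obtain ⟨j, hj⟩ := hc.2.2 (φ x) (hc.2.1 x hx) x hx
  exact Function.mk_mem_periodicPts (Nat.succ_pos j) hj

theorem IsCycleSet.eq_toFinset_periodicOrbit (hc : IsCycleSet φ c) (hx : x ∈ c) :
    c = (Function.periodicOrbit φ x).toFinset := by
  ext y
  have hmem : y ∈ (Function.periodicOrbit φ x).toFinset ↔ y ∈ Function.periodicOrbit φ x := by
    rw [Cycle.toFinset, Function.periodicOrbit, Cycle.coe_toMultiset, Multiset.mem_toFinset,
      Multiset.mem_coe, Cycle.mem_coe_iff]
  rw [hmem, Function.mem_periodicOrbit_iff (hc.mem_periodicPts hx)]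
  clear hmem
  constructor
  · exact hc.2.2 x hx y
  · rintro ⟨n, rfl⟩
    induction n with
    | zero => exact hx
    | succ n ih =>
      rw [Function.iterate_succ_apply']
      exact hc.2.1 _ ih

theorem IsCycleSet.minimalPeriod_eq (hc : IsCycleSet φ c) (hx : x ∈ c) :
    Function.minimalPeriod φ x = c.card := by
  rw [hc.eq_toFinset_periodicOrbit hx, ← Function.periodicOrbit_length, Cycle.toFinset,
    Function.periodicOrbit, Cycle.coe_toMultiset, Cycle.length_coe]
  rw [Multiset.toFinset_card_of_nodup]
  · simp
  · exact Function.nodup_periodicOrbit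

theorem IsCycleSet.eq_of_mem (hc : IsCycleSet φ c) (hc' : IsCycleSet φ c') (hx : x ∈ c)
    (hx' : x ∈ c') : c = c' :=
  (hc.eq_toFinset_periodicOrbit hx).trans (hc'.eq_toFinset_periodicOrbit hx').symm

/-- The cyclic successor on `Fin k`. -/
def cyclicSucc {k : ℕ} (i : Fin k) : Fin k := ⟨(i + 1) % k, Nat.mod_lt _ i.pos⟩

/-- The finset of cycles of a self-map of a finite type. -/
noncomputable def cycleFinset [Fintype S] (φ : S → S) : Finset (Finset S) :=
  Finset.univ.filter (IsCycleSet φ)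

theorem mem_cycleFinset [Fintype S] : c ∈ cycleFinset φ ↔ IsCycleSet φ c := by
  simp [cycleFinset]

theorem mul_card_cycles_le_natCard_embedding [Fintype S] (k : ℕ) :
    k * ((cycleFinset φ).filter fun c => c.card = k).card
      ≤ Nat.card {α : Fin k ↪ S // ∀ i, φ (α i) = α (cyclicSucc i)} := by
  set C := (cycleFinset φ).filter fun c => c.card = k with hC
  have hmem : ∀ c : C, IsCycleSet φ c.1 ∧ c.1.card = k := by
    intro c
    have h := Finset.mem_filter.1 c.2
    exact ⟨mem_cycleFinset.1 h.1, h.2⟩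
  have hcard : Nat.card (Σ c : C, c.1) = k * C.card := by
    rw [Nat.card_sigma]
    simp only [Nat.card_eq_fintype_card, Fintype.card_coe]
    rw [Finset.sum_congr rfl fun c _ => (hmem c).2]
    simp [mul_comm]
  rw [← hcard]
  have hper : ∀ t : (Σ c : C, c.1), Function.minimalPeriod φ t.2.1 = k :=
    fun t => ((hmem t.1).1.minimalPeriod_eq t.2.2).trans (hmem t.1).2
  refine Nat.card_le_card_of_injective (fun t => ⟨⟨fun i => φ^[i] t.2.1, ?_⟩, ?_⟩) ?_
  · intro i i' h
    refine Fin.ext (Function.iterate_injOn_Iio_minimalPeriod ?_ ?_ h)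
    · rw [hper t]
      exact i.2
    · rw [hper t]
      exact i'.2
  · intro i
    change φ (φ^[i] t.2.1) = φ^[(i + 1) % k] t.2.1
    rw [← Function.iterate_succ_apply' φ]
    have h := Function.iterate_mod_minimalPeriod_eq (f := φ) (x := t.2.1) (n := i + 1)
    rw [hper t] at h
    exact h.symm
  · rintro ⟨c, x⟩ ⟨c', x'⟩ h
    have hk : 0 < k := by
      rw [← (hmem c).2]
      exact Finset.card_pos.2 (hmem c).1.1
    have hx : x.1 = x'.1 :=
      congrFun (congrArg (fun α => (α.1 : Fin k → S)) h) ⟨0, hk⟩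
    have hcc : c = c' :=
      Subtype.ext ((hmem c).1.eq_of_mem (hmem c').1 x.2 (by rw [hx]; exact x'.2))
    subst hcc
    rw [Subtype.ext hx]

theorem mul_card_long_cycles_le [Fintype S] (m : ℕ) :
    m * ((cycleFinset φ).filter fun c => m ≤ c.card).card ≤ Fintype.card S := by
  set C := (cycleFinset φ).filter fun c => m ≤ c.card with hC
  have hmem : ∀ c ∈ C, IsCycleSet φ c ∧ m ≤ c.card := by
    intro c hc
    rwa [hC, Finset.mem_filter, mem_cycleFinset] at hc
  calc m * C.card = ∑ _c ∈ C, m := by simp [mul_comm]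
    _ ≤ ∑ c ∈ C, c.card := Finset.sum_le_sum fun c hc => (hmem c hc).2
    _ = (C.biUnion id).card := by
      refine (Finset.card_biUnion ?_).symm
      intro c hc c' hc' hne
      refine Finset.disjoint_left.2 ?_
      intro x hx hx'
      exact hne ((hmem c hc).1.eq_of_mem (hmem c' hc').1 hx hx')
    _ ≤ Fintype.card S := Finset.card_le_univ _

theorem card_cycles_le_sum [Fintype S] (m : ℕ) :
    (cycleFinset φ).card
      ≤ ∑ k ∈ Finset.Icc 1 m, ((cycleFinset φ).filter fun c => c.card = k).card
        + ((cycleFinset φ).filter fun c => m + 1 ≤ c.card).card := by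
  rw [← Finset.card_filter_add_card_filter_not (s := cycleFinset φ) (fun c => c.card ≤ m)]
  gcongr ?_ + ?_
  · rw [Finset.card_eq_sum_card_fiberwise (f := Finset.card) (t := Finset.Icc 1 m)]
    · refine Finset.sum_le_sum fun k _ => Finset.card_le_card ?_
      rw [Finset.filter_filter]
      exact Finset.monotone_filter_right _ fun c _ hc => hc.2
    · intro c hc
      simp only [Finset.coe_filter, Set.mem_ofPred_eq, mem_cycleFinset] at hc
      simp only [Finset.coe_Icc, Set.mem_Icc]
      exact ⟨Finset.card_pos.2 hc.1.1, hc.2⟩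
  · refine Finset.card_le_card (Finset.monotone_filter_right _ fun c _ hc => ?_)
    exact not_le.1 hc

end Cycles

section CycleCounting

variable {F : Type} [Field F] [Fintype F]

/-- The self-map of the projective line induced by a coprime pair. -/
noncomputable def coprimePairMap {d : ℕ} (p : CoprimePair F d) : Option F → Option F :=
  ratMap p.1.1 p.1.2

noncomputable instance fintype_coprimePair (d : ℕ) : Fintype (CoprimePair F d) :=
  Fintype.ofFinite _

theorem mul_sum_cycles_le {d : ℕ} (k M : ℕ)
    (hM : ∀ α : Fin k ↪ Option F,
      Nat.card {p : CoprimePair F d // ∀ i, ratMap p.1.1 p.1.2 (α i) = α (cyclicSucc i)} ≤ M) :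
    k * ∑ p : CoprimePair F d, ((cycleFinset (coprimePairMap p)).filter fun c => c.card = k).card
      ≤ (Fintype.card F + 1).descFactorial k * M := by
  rw [Finset.mul_sum]
  calc _ ≤ ∑ p : CoprimePair F d,
        Nat.card {α : Fin k ↪ Option F // ∀ i, coprimePairMap p (α i) = α (cyclicSucc i)} :=
        Finset.sum_le_sum fun p _ => mul_card_cycles_le_natCard_embedding k
    _ = ∑ α : Fin k ↪ Option F,
        Nat.card {p : CoprimePair F d // ∀ i, ratMap p.1.1 p.1.2 (α i) = α (cyclicSucc i)} := by
      simp only [Nat.card_eq_fintype_card, Fintype.card_subtype, Finset.card_filter]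
      exact Finset.sum_comm
    _ ≤ ∑ _α : Fin k ↪ Option F, M := Finset.sum_le_sum fun α _ => hM α
    _ = _ := by simp [Fintype.card_embedding_eq]

theorem sum_fixed_cycles_le {d : ℕ} (hd : 0 < d) :
    1 * ∑ p : CoprimePair F d, ((cycleFinset (coprimePairMap p)).filter fun c => c.card = 1).card
      ≤ Fintype.card (CoprimePair F d) := by
  have h := natCard_coprimePair_fixed (F := F) hd none none
  rw [Nat.card_eq_fintype_card, Nat.card_eq_fintype_card (α := CoprimePair F d)] at h
  rw [← h]
  refine (mul_sum_cycles_le 1 _ ?_).trans_eq (by rw [Nat.descFactorial_one])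
  intro α
  have hα : cyclicSucc (0 : Fin 1) = 0 := Subsingleton.elim _ _
  have h' := natCard_coprimePair_fixed (F := F) hd (α 0) (α 0)
  rw [Nat.card_eq_fintype_card (α := F), Nat.card_eq_fintype_card (α := CoprimePair F d), ← h] at h'
  have h'' := Nat.eq_of_mul_eq_mul_left (Nat.succ_pos _) h'
  rw [← h'']
  simp only [Fin.forall_fin_one, hα]
  exact le_rfl

theorem descFactorial_succ_succ_le (q i : ℕ) :
    (q + 1).descFactorial (i + 2) ≤ (q + 1) * q * (q - 1) ^ i := by
  induction i with
  | zero => simp [Nat.descFactorial_succ, mul_comm]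
  | succ i ih =>
    rw [show i + 1 + 2 = (i + 2) + 1 from rfl, Nat.descFactorial_succ, pow_succ, ← mul_assoc,
      mul_comm]
    exact Nat.mul_le_mul ih (by omega)

theorem mul_sum_cycles_le_card {d : ℕ} (j k : ℕ) (hj : 2 ≤ j) (hjk : j ≤ k) (hjd : j ≤ d + 1)
    (hdesc : (Fintype.card F + 1).descFactorial k = (Fintype.card F + 1).descFactorial j) :
    k * ∑ p : CoprimePair F d, ((cycleFinset (coprimePairMap p)).filter fun c => c.card = k).card
      ≤ Fintype.card (CoprimePair F d) := by
  obtain ⟨n, rfl⟩ : ∃ n, d = n + 1 := ⟨d - 1, by omega⟩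
  obtain ⟨i, rfl⟩ : ∃ i, j = i + 2 := ⟨j - 2, by omega⟩
  have hin : i ≤ n := by omega
  have hP := natCard_coprimePair_ge (F := F) n
  rw [Nat.card_eq_fintype_card, Nat.card_eq_fintype_card] at hP
  have hq : 1 ≤ Fintype.card F := Fintype.card_pos
  set q := Fintype.card F with hqdef
  rw [← Nat.cast_one, ← Nat.cast_sub hq, ← Nat.cast_add] at hP
  norm_cast at hP
  refine (mul_sum_cycles_le k ((q - 1) ^ (i + 2) * q ^ (2 * (n - i))) ?_).trans (le_trans ?_ hP)
  · intro α
    have h := natCard_coprimePair_interpolation_le (Nat.succ_pos n) hjd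
      ((Fin.castLEEmb hjk).trans α) (fun i => α (cyclicSucc (Fin.castLE hjk i)))
    rw [Nat.card_eq_fintype_card (α := F), ← hqdef,
      show n + 1 + 1 - (i + 2) = n - i by omega] at h
    refine le_trans (Nat.card_le_card_of_injective
      (fun p => ⟨p.1, fun i => p.2 (Fin.castLE hjk i)⟩) ?_) h
    intro p p' hpp
    exact Subtype.ext (congrArg (fun x => x.1) hpp)
  · rw [← hqdef, hdesc]
    calc _ ≤ (q + 1) * q * (q - 1) ^ i * ((q - 1) ^ (i + 2) * q ^ (2 * (n - i))) :=
          Nat.mul_le_mul_right _ (descFactorial_succ_succ_le q i)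
      _ = (q + 1) * (q - 1) ^ 2 * (q * (q - 1) ^ (2 * i) * q ^ (2 * (n - i))) := by ring
      _ ≤ (q + 1) * (q - 1) ^ 2 * (q * q ^ (2 * i) * q ^ (2 * (n - i))) := by
        gcongr
        exact Nat.sub_le q 1
      _ = _ := by
        rw [mul_assoc q, ← pow_add, ← pow_succ', ← mul_add, Nat.add_sub_cancel' hin]

theorem sum_cycles_le_div {d k : ℕ} (hd : 0 < d) (hk : 1 ≤ k) (hkq : k ≤ Fintype.card F + 1)
    (hkd : k ≤ d + 1 ∨ Fintype.card F ≤ d + 1) :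
    (∑ p : CoprimePair F d,
      (((cycleFinset (coprimePairMap p)).filter fun c => c.card = k).card : ℝ))
      ≤ Fintype.card (CoprimePair F d) * (1 / k) := by
  have hq : 1 < Fintype.card F := Fintype.one_lt_card
  have key : k * ∑ p : CoprimePair F d,
      ((cycleFinset (coprimePairMap p)).filter fun c => c.card = k).card
      ≤ Fintype.card (CoprimePair F d) := by
    obtain rfl | hk2 := hk.eq_or_lt
    · exact sum_fixed_cycles_le hd
    · by_cases hkd' : k ≤ d + 1
      · exact mul_sum_cycles_le_card k k hk2 le_rfl hkd' rfl
      · obtain rfl : k = Fintype.card F + 1 := by omega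
        refine mul_sum_cycles_le_card (Fintype.card F) _ hq (Nat.le_succ _) (by omega) ?_
        rw [Nat.descFactorial_succ]
        simp
  have hk0 : (0 : ℝ) < k := by exact_mod_cast hk
  rw [mul_one_div, le_div_iff₀ hk0, mul_comm]
  exact_mod_cast key

end CycleCounting

section Quotient

variable {F : Type} [Field F]

theorem equivalence_scaleRel (d : ℕ) :
    Equivalence (fun p₁ p₂ : CoprimePair F d => ScaleRel p₁.1 p₂.1) where
  refl p := ⟨1, one_ne_zero, by simp, by simp⟩
  symm := by
    rintro p p' ⟨c, hc, h1, h2⟩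
    exact ⟨c⁻¹, inv_ne_zero hc, by rw [h1, inv_smul_smul₀ hc], by rw [h2, inv_smul_smul₀ hc]⟩
  trans := by
    rintro p p' p'' ⟨c, hc, h1, h2⟩ ⟨c', hc', h1', h2'⟩
    exact ⟨c' * c, mul_ne_zero hc' hc, by rw [h1', h1, mul_smul], by rw [h2', h2, mul_smul]⟩

theorem ratFn_mk_eq_iff {d : ℕ} {p p' : CoprimePair F d} :
    (Quot.mk _ p : RatFn F d) = Quot.mk _ p' ↔ ScaleRel p.1 p'.1 :=
  ⟨fun h => (equivalence_scaleRel d).eqvGen_iff.1 (Quot.eqvGen_exact h), fun h => Quot.sound h⟩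

theorem projPoint_smul {c : F} (hc : c ≠ 0) (w : F × F) : projPoint (c • w) = projPoint w := by
  obtain ⟨u, v⟩ := w
  rw [Prod.smul_mk, projPoint_mk, projPoint_mk]
  simp [hc, mul_div_mul_left]

theorem coprimePairMap_eq_of_scaleRel {d : ℕ} (hd : 0 < d) {p p' : CoprimePair F d}
    (h : ScaleRel p.1 p'.1) : coprimePairMap p = coprimePairMap p' := by
  obtain ⟨c, hc, h1, h2⟩ := h
  funext x
  rw [coprimePairMap, coprimePairMap, ratMap_eq_projPoint hd, ratMap_eq_projPoint hd,
    ← projPoint_smul hc]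
  congr 1
  simp [evalPair, h1, h2]

/-- Multiplication of a coprime pair by a nonzero scalar. -/
noncomputable def scalePair {d : ℕ} (u : Fˣ) (p : CoprimePair F d) : CoprimePair F d :=
  ⟨((u : F) • p.1.1, (u : F) • p.1.2), by
    have hu : IsUnit (C (u : F)) := isUnit_C.2 u.isUnit
    rw [smul_eq_C_mul, smul_eq_C_mul]
    exact (isCoprime_mul_unit_left hu _ _).2 p.2.1, by
    rw [natDegree_smul _ u.ne_zero, natDegree_smul _ u.ne_zero]
    exact p.2.2⟩

theorem scaleRel_scalePair {d : ℕ} (u : Fˣ) (p : CoprimePair F d) :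
    ScaleRel p.1 (scalePair u p).1 :=
  ⟨u, u.ne_zero, rfl, rfl⟩

theorem bijective_scalePair_out (d : ℕ) :
    Function.Bijective (fun t : RatFn F d × Fˣ => scalePair t.2 (Quot.out t.1)) := by
  constructor
  · rintro ⟨x, u⟩ ⟨x', u'⟩ h
    simp only at h
    have h1 := (ratFn_mk_eq_iff.2 (scaleRel_scalePair u (Quot.out x)))
    have h2 := (ratFn_mk_eq_iff.2 (scaleRel_scalePair u' (Quot.out x')))
    rw [h, ← h2] at h1
    have hx : x = x' := (Quot.out_eq x).symm.trans (h1.trans (Quot.out_eq x'))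
    subst hx
    congr 1
    have hf := congrArg (fun p : CoprimePair F d => p.1.1) h
    have hg := congrArg (fun p : CoprimePair F d => p.1.2) h
    simp only [scalePair] at hf hg
    by_cases h0 : (Quot.out x).1.1 = 0
    · have h0' : (Quot.out x).1.2 ≠ 0 := by
        intro h0'
        have := (Quot.out x).2.1
        rw [h0, h0'] at this
        exact not_isCoprime_zero_zero this
      exact Units.ext (smul_left_injective F h0' hg)
    · exact Units.ext (smul_left_injective F h0 hf)
  · intro p
    obtain ⟨c, hc, h1, h2⟩ := ratFn_mk_eq_iff.1 (Quot.out_eq (Quot.mk _ p : RatFn F d))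
    exact ⟨(Quot.mk _ p, Units.mk0 c hc), Subtype.ext (Prod.ext h1.symm h2.symm)⟩

variable [Fintype F]

instance finite_ratFn (d : ℕ) : Finite (RatFn F d) :=
  Finite.of_surjective (fun p : CoprimePair F d => (Quot.mk _ p : RatFn F d)) Quot.mk_surjective

noncomputable instance fintype_ratFn (d : ℕ) : Fintype (RatFn F d) := Fintype.ofFinite _

theorem sum_coprimePair_eq {d : ℕ} (n : CoprimePair F d → ℕ)
    (hn : ∀ p p' : CoprimePair F d, ScaleRel p.1 p'.1 → n p = n p') :
    ∑ p, n p = Fintype.card Fˣ * ∑ x : RatFn F d, n (Quot.out x) := by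
  rw [← (bijective_scalePair_out d).sum_comp, Fintype.sum_prod_type, Finset.mul_sum]
  refine Finset.sum_congr rfl fun x _ => ?_
  rw [Finset.sum_congr rfl fun u _ => (hn _ _ (scaleRel_scalePair u (Quot.out x))).symm]
  simp

theorem natCard_ratFn_cycles {d : ℕ} (hd : 0 < d) :
    Nat.card {x : RatFn F d × Finset (Option F) //
          ∃ p, Quot.mk _ p = x.1 ∧ IsCycleSet (ratMap p.1.1 p.1.2) x.2}
      = ∑ x : RatFn F d, (cycleFinset (coprimePairMap (Quot.out x))).card := by
  have h : ∀ x : RatFn F d × Finset (Option F),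
      (∃ p, Quot.mk _ p = x.1 ∧ IsCycleSet (ratMap p.1.1 p.1.2) x.2)
        ↔ IsCycleSet (coprimePairMap (Quot.out x.1)) x.2 := by
    rintro ⟨x, c⟩
    constructor
    · rintro ⟨p, rfl, hp⟩
      rw [coprimePairMap_eq_of_scaleRel hd (ratFn_mk_eq_iff.1 (Quot.out_eq _))]
      exact hp
    · intro h
      exact ⟨Quot.out x, Quot.out_eq x, h⟩
  rw [Nat.card_congr (Equiv.subtypeEquivRight h),
    Nat.card_congr (Equiv.subtypeProdEquivSigmaSubtype
      fun (x : RatFn F d) c => IsCycleSet (coprimePairMap (Quot.out x)) c), Nat.card_sigma]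
  refine Finset.sum_congr rfl fun x _ => ?_
  rw [Nat.card_eq_fintype_card, Fintype.card_subtype]
  rfl

theorem average_eq {d : ℕ} (hd : 0 < d) :
    (Nat.card {x : RatFn F d × Finset (Option F) //
          ∃ p, Quot.mk _ p = x.1 ∧ IsCycleSet (ratMap p.1.1 p.1.2) x.2} : ℝ) /
        (Nat.card (RatFn F d) : ℝ)
      = (∑ p : CoprimePair F d, ((cycleFinset (coprimePairMap p)).card : ℝ))
        / Fintype.card (CoprimePair F d) := by
  have h1 := sum_coprimePair_eq (fun p : CoprimePair F d => (cycleFinset (coprimePairMap p)).card)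
    (fun p p' h => by rw [coprimePairMap_eq_of_scaleRel hd h])
  have h2 := sum_coprimePair_eq (fun _ : CoprimePair F d => 1) (fun _ _ _ => rfl)
  simp only [Finset.sum_const, Finset.card_univ, smul_eq_mul, mul_one] at h2
  have hu : (Fintype.card Fˣ : ℝ) ≠ 0 := Nat.cast_ne_zero.2 Fintype.card_ne_zero
  rw [natCard_ratFn_cycles hd, ← Nat.cast_sum, h1, h2, Nat.card_eq_fintype_card, Nat.cast_mul,
    Nat.cast_mul, mul_div_mul_left _ _ hu]

theorem average_le {d : ℕ} (hd : 0 < d) (m : ℕ) (hm : m ≤ Fintype.card F + 1)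
    (hmd : m ≤ d + 1 ∨ Fintype.card F ≤ d + 1) :
    (∑ p : CoprimePair F d, ((cycleFinset (coprimePairMap p)).card : ℝ))
        / Fintype.card (CoprimePair F d)
      ≤ (∑ p : CoprimePair F d,
          (((cycleFinset (coprimePairMap p)).filter fun c => m + 1 ≤ c.card).card : ℝ))
          / Fintype.card (CoprimePair F d)
        + ∑ k ∈ Finset.Icc 1 m, (1 : ℝ) / k := by
  obtain hP | hP := Nat.eq_zero_or_pos (Fintype.card (CoprimePair F d))
  · rw [hP, Nat.cast_zero, div_zero, div_zero, zero_add]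
    positivity
  have hP' : (0 : ℝ) < Fintype.card (CoprimePair F d) := by exact_mod_cast hP
  rw [div_add' _ _ _ hP'.ne', div_le_div_iff_of_pos_right hP', add_comm]
  calc (∑ p : CoprimePair F d, ((cycleFinset (coprimePairMap p)).card : ℝ))
      ≤ ∑ p : CoprimePair F d, (∑ k ∈ Finset.Icc 1 m,
          (((cycleFinset (coprimePairMap p)).filter fun c => c.card = k).card : ℝ)
          + (((cycleFinset (coprimePairMap p)).filter fun c => m + 1 ≤ c.card).card : ℝ)) := by
        refine Finset.sum_le_sum fun p _ => ?_
        exact_mod_cast card_cycles_le_sum m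
    _ ≤ _ := by
      rw [Finset.sum_add_distrib, Finset.sum_comm, mul_comm, Finset.mul_sum]
      gcongr with k hk
      rw [Finset.mem_Icc] at hk
      exact sum_cycles_le_div hd hk.1 (hk.2.trans hm) (hmd.imp_left hk.2.trans)

theorem average_long_cycles_le {d : ℕ} (m : ℕ) (hm : 0 < m) :
    (∑ p : CoprimePair F d,
        (((cycleFinset (coprimePairMap p)).filter fun c => m ≤ c.card).card : ℝ))
      / Fintype.card (CoprimePair F d) ≤ (Fintype.card F + 1) / m := by
  have hm' : (0 : ℝ) < m := by exact_mod_cast hm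
  refine div_le_of_le_mul₀ (Nat.cast_nonneg _) (by positivity) ?_
  calc _ ≤ ∑ _p : CoprimePair F d, ((Fintype.card F + 1) / m : ℝ) := by
        refine Finset.sum_le_sum fun p _ => ?_
        rw [le_div_iff₀ hm', mul_comm]
        have := mul_card_long_cycles_le (φ := coprimePairMap p) m
        rw [Fintype.card_option] at this
        exact_mod_cast this
    _ = _ := by simp [mul_comm]

end Quotient

/-- **Corollary 3.7.** The average number `R(q,d)` of cycles of a rational function on
`P¹(F_q)` of degree exactly `d` satisfies `R(q,d) ≤ (q+1)/(d+2) + (1 + 2/q²)Σ_{k=1}^{d+1} 1/k`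
when `d < q - 1`, and `R(q,d) ≤ (1 + 2/q²)Σ_{k=1}^{q+1} 1/k` when `d ≥ q - 1`. -/
theorem avg_cycles_of_rational_functions_upper_bound
    (q d : ℕ) (F : Type) [Field F] [Fintype F] (hF : Fintype.card F = q)
    (hd : 0 < d)
    (R : ℝ)
    (hR : R = (Nat.card {x : RatFn F d × Finset (Option F) //
          ∃ p, Quot.mk _ p = x.1 ∧ IsCycleSet (ratMap p.1.1 p.1.2) x.2} : ℝ) /
        (Nat.card (RatFn F d) : ℝ)) :
    (d < q - 1 →
      R ≤ ((q : ℝ) + 1) / (d + 2)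
            + (1 + 2 / (q : ℝ) ^ 2) * ∑ k ∈ Finset.Icc 1 (d + 1), (1 : ℝ) / k) ∧
    (q - 1 ≤ d →
      R ≤ (1 + 2 / (q : ℝ) ^ 2) * ∑ k ∈ Finset.Icc 1 (q + 1), (1 : ℝ) / k) := by
  subst hF
  rw [average_eq hd] at hR
  have hq : 1 < Fintype.card F := Fintype.one_lt_card
  have hle : ∀ m : ℕ, ∑ k ∈ Finset.Icc 1 m, (1 : ℝ) / k
      ≤ (1 + 2 / (Fintype.card F : ℝ) ^ 2) * ∑ k ∈ Finset.Icc 1 m, (1 : ℝ) / k := by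
    intro m
    refine le_mul_of_one_le_left (by positivity) ?_
    rw [le_add_iff_nonneg_right]
    positivity
  subst hR
  constructor
  · intro hdq
    refine (average_le hd (d + 1) (by omega) (Or.inl le_rfl)).trans (add_le_add ?_ (hle _))
    exact_mod_cast average_long_cycles_le (F := F) (d := d) (d + 2) (by omega)
  · intro hdq
    refine (average_le hd (Fintype.card F + 1) le_rfl (Or.inr (by omega))).trans
      (le_trans (le_of_eq ?_) (hle _))
    rw [add_eq_right, Finset.sum_eq_zero, zero_div]
    intro p _
    rw [Nat.cast_eq_zero, Finset.card_eq_zero, Finset.filter_eq_empty_iff]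
    intro c _ hc
    have := Finset.card_le_univ c
    rw [Fintype.card_option] at this
    omega
end

section
/- Let q be a prime power and d a positive integer. The average number of periodic points in P^1(F_q), taken over all rational functions on P^1(F_q) of degree exactly d, is at least Σ_{k=1}^{min{d,q}} ((q+1)·q⋯(q−(k−1)) / q^k)·(1 − (k+4)/q). In particular, this average is at least (5/6)·min{d, ⌊√q⌋} − 3. -/
open Polynomial
open scoped Classical

namespace RatFnCount

/-- The value at a point of `P¹(F)` of a form of degree `e`, written as a polynomial of degree at
most `e`: evaluation at a finite point, the coefficient of `X ^ e` at `∞`. -/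
noncomputable def projEval {F : Type*} [Field F] (e : ℕ) : Option F → F[X] →ₗ[F] F
  | some a => leval a
  | none => lcoeff F e

/-- The line in `F × F` of homogeneous coordinates of a point of `P¹(F)`, together with `0`. -/
noncomputable def projLine {F : Type*} [Field F] [Fintype F] : Option F → Finset (F × F)
  | some c => Finset.univ.filter fun v => v.1 = c * v.2
  | none => Finset.univ.filter fun v => v.2 = 0

/-- The pairs of polynomials of degree at most `e` whose values at each `s ∈ S`, as forms of
degree `e`, lie in `U s`. -/
def interpPairs {F : Type*} [Field F] (e : ℕ) (S : Finset (Option F))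
    (U : Option F → Finset (F × F)) : Set (F[X] × F[X]) :=
  {p | p.1 ∈ degreeLT F (e + 1) ∧ p.2 ∈ degreeLT F (e + 1) ∧
    ∀ s ∈ S, (projEval e s p.1, projEval e s p.2) ∈ U s}

section Interpolation

variable {F : Type*} [Field F]

@[simp] lemma projEval_some (e : ℕ) (a : F) (f : F[X]) : projEval e (some a) f = f.eval a := rfl

@[simp] lemma projEval_none (e : ℕ) (f : F[X]) : projEval e none f = f.coeff e := rfl

lemma exists_projEval_eq {e : ℕ} {S : Finset (Option F)} (hS : S.card ≤ e + 1)
    (t : Option F → F) : ∃ f ∈ degreeLT F (e + 1), ∀ s ∈ S, projEval e s f = t s := by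
  set S₀ := S.eraseNone with hS₀
  set f₀ := Lagrange.interpolate S₀ id (fun a => t (some a)) with hf₀
  have hdeg : f₀.degree < S₀.card := Lagrange.degree_interpolate_lt _ Function.injective_id.injOn
  have hev : ∀ a, some a ∈ S → f₀.eval a = t (some a) := fun a ha =>
    Lagrange.eval_interpolate_at_node (v := id) (fun a => t (some a))
      Function.injective_id.injOn (by simpa [hS₀] using ha)
  by_cases h : none ∈ S
  · have hc : S₀.card ≤ e := by
      have h1 := Finset.card_eraseNone_of_mem h
      have h2 := Finset.card_pos.2 ⟨_, h⟩
      rw [← hS₀] at h1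
      omega
    have hmon : (Lagrange.nodal S₀ id * X ^ (e - S₀.card) : F[X]).Monic :=
      Lagrange.nodal_monic.mul (monic_X_pow _)
    have hnat : (Lagrange.nodal S₀ id * X ^ (e - S₀.card) : F[X]).natDegree = e := by
      rw [Lagrange.nodal_monic.natDegree_mul (monic_X_pow _), Lagrange.natDegree_nodal,
        natDegree_X_pow]
      omega
    refine ⟨f₀ + C (t none) * (Lagrange.nodal S₀ id * X ^ (e - S₀.card)), ?_, ?_⟩
    · refine Submodule.add_mem _ (mem_degreeLT.2 (hdeg.trans_le ?_)) (mem_degreeLT.2 ?_)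
      · exact_mod_cast hc.trans (Nat.le_succ e)
      · rw [← smul_eq_C_mul]
        refine (degree_smul_le _ _).trans_lt ?_
        rw [degree_eq_natDegree hmon.ne_zero, hnat]
        exact_mod_cast Nat.lt_succ_self e
    · rintro (_ | a) hs
      · have h0 : f₀.coeff e = 0 := coeff_eq_zero_of_degree_lt (hdeg.trans_le (by exact_mod_cast hc))
        have h1 : (Lagrange.nodal S₀ id * X ^ (e - S₀.card) : F[X]).coeff e = 1 := by
          have := hmon.coeff_natDegree
          rwa [hnat] at this
        rw [projEval_none, coeff_add, coeff_C_mul, h0, h1, zero_add, mul_one]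
      · have h0 : (Lagrange.nodal S₀ id : F[X]).eval a = 0 :=
          Lagrange.eval_nodal_at_node (v := id) (by simpa [hS₀] using hs)
        simp [h0, hev a hs]
  · refine ⟨f₀, mem_degreeLT.2 (hdeg.trans_le ?_), ?_⟩
    · rw [hS₀, Finset.card_eraseNone_of_not_mem h]
      exact_mod_cast hS
    · rintro (_ | a) hs
      · exact absurd hs h
      · exact hev a hs

lemma eq_zero_of_projEval_eq_zero {e : ℕ} {S : Finset (Option F)} (hS : e + 1 ≤ S.card)
    {f : F[X]} (hf : f ∈ degreeLT F (e + 1)) (h : ∀ s ∈ S, projEval e s f = 0) : f = 0 := by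
  rw [mem_degreeLT] at hf
  refine eq_zero_of_degree_lt_of_eval_finset_eq_zero S.eraseNone ?_ fun a ha =>
    h (some a) (by simpa using ha)
  by_cases hn : none ∈ S
  · have h0 : f.coeff e = 0 := h none hn
    have : f.degree < e := by
      refine (degree_lt_iff_coeff_zero _ _).2 fun m hm => ?_
      rcases hm.eq_or_lt with rfl | hm
      · exact h0
      · exact (degree_lt_iff_coeff_zero _ _).1 hf m hm
    refine this.trans_le ?_
    have := Finset.card_eraseNone_of_mem hn
    exact_mod_cast (by omega : e ≤ S.eraseNone.card)
  · rw [Finset.card_eraseNone_of_not_mem hn]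
    exact hf.trans_le (by exact_mod_cast hS)

lemma eq_zero_of_projEval_eq_zero_of_mem_projLine [Fintype F] {e : ℕ} {S : Finset (Option F)}
    (hS : e ≤ S.card) {a b a' b' : Option F} (ha : a ∉ S) (hb : b ∉ S) (hab : a' ≠ b')
    {f g : F[X]} (hf : f ∈ degreeLT F (e + 1)) (hg : g ∈ degreeLT F (e + 1))
    (hfS : ∀ s ∈ S, projEval e s f = 0) (hgS : ∀ s ∈ S, projEval e s g = 0)
    (hfa : (projEval e a f, projEval e a g) ∈ projLine a')
    (hfb : (projEval e b f, projEval e b g) ∈ projLine b') : f = 0 ∧ g = 0 := by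
  have hz : ∀ c ∉ S, ∀ u ∈ degreeLT F (e + 1), (∀ s ∈ S, projEval e s u = 0) →
      projEval e c u = 0 → u = 0 := by
    intro c hc u hu huS huc
    refine eq_zero_of_projEval_eq_zero (S := insert c S) ?_ hu ?_
    · rw [Finset.card_insert_of_notMem hc]; omega
    · simpa [huc] using huS
  have hu : projEval e a g • f - projEval e a f • g = 0 := by
    refine hz a ha _ (Submodule.sub_mem _ (Submodule.smul_mem _ _ hf)
      (Submodule.smul_mem _ _ hg)) ?_ ?_
    · intro s hs; simp [hfS s hs, hgS s hs]
    · simp [mul_comm]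
  have hb' : projEval e a g * projEval e b f - projEval e a f * projEval e b g = 0 := by
    simpa using congrArg (projEval e b) hu
  have key : (projEval e a f = 0 ∧ projEval e a g = 0) ∨
      (projEval e b f = 0 ∧ projEval e b g = 0) := by
    generalize projEval e a f = x at *
    generalize projEval e a g = y at *
    generalize projEval e b f = z at *
    generalize projEval e b g = w at *
    rcases a' with _ | a' <;> rcases b' with _ | b'
    · exact absurd rfl hab
    · simp only [projLine, Finset.mem_filter, Finset.mem_univ, true_and] at hfa hfb
      subst hfa hfb
      have : x * w = 0 := by linear_combination -hb'
      rcases mul_eq_zero.1 this with h | h <;> simp [h]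
    · simp only [projLine, Finset.mem_filter, Finset.mem_univ, true_and] at hfa hfb
      subst hfa hfb
      have : y * z = 0 := by linear_combination hb'
      rcases mul_eq_zero.1 this with h | h <;> simp [h]
    · simp only [projLine, Finset.mem_filter, Finset.mem_univ, true_and] at hfa hfb
      subst hfa hfb
      have h1 : (a' - b') * (y * w) = 0 := by linear_combination -hb'
      have h2 : a' - b' ≠ 0 := sub_ne_zero.2 fun h => hab (by rw [h])
      rcases mul_eq_zero.1 ((mul_eq_zero.1 h1).resolve_left h2) with h | h <;> simp [h]
  rcases key with h | h
  · exact ⟨hz a ha f hf hfS h.1, hz a ha g hg hgS h.2⟩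
  · exact ⟨hz b hb f hf hfS h.1, hz b hb g hg hgS h.2⟩

end Interpolation

lemma ncard_preimage_mul_card {G H : Type*} [AddCommGroup G] [AddCommGroup H] [Finite G]
    (φ : G →+ H) (hφ : Function.Surjective φ) (U : Set H) :
    (φ ⁻¹' U).ncard * Nat.card H = Nat.card G * U.ncard := by
  have hfin : Finite H := Finite.of_surjective _ hφ
  have key : ∀ V : Set H, (φ ⁻¹' V).ncard = V.ncard * Nat.card φ.ker := by
    intro V
    obtain ⟨r, hr⟩ := hφ.hasRightInverse
    rw [← Nat.card_coe_set_eq, ← Nat.card_coe_set_eq, ← Nat.card_prod]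
    refine Nat.card_congr ⟨fun x => (⟨φ x.1, x.2⟩, ⟨x.1 - r (φ x.1), by simp [AddMonoidHom.mem_ker, hr (φ x.1)]⟩),
      fun x => ⟨r x.1.1 + x.2.1, ?_⟩, ?_, ?_⟩
    · have := x.2.2
      rw [AddMonoidHom.mem_ker] at this
      simp [this, hr x.1.1]
    · intro x; simp
    · rintro ⟨⟨x, hx⟩, ⟨y, hy⟩⟩
      rw [AddMonoidHom.mem_ker] at hy
      simp [hy, hr x]
  have h1 := key Set.univ
  rw [Set.preimage_univ, Set.ncard_univ, Set.ncard_univ] at h1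
  rw [key, h1]
  ring

section Counting

variable {F : Type*} [Field F] [Fintype F]

lemma card_degreeLT (n : ℕ) : Nat.card (degreeLT F n) = Fintype.card F ^ n := by
  rw [Nat.card_congr (degreeLTEquiv F n).toEquiv]
  simp

instance finite_degreeLT (n : ℕ) : Finite (degreeLT F n) :=
  Finite.of_equiv _ (degreeLTEquiv F n).toEquiv.symm

lemma finite_interpPairs (e : ℕ) (S : Finset (Option F)) (U : Option F → Finset (F × F)) :
    (interpPairs e S U).Finite :=
  have h : (degreeLT F (e + 1) : Set F[X]).Finite := finite_degreeLT (e + 1)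
  (h.prod h).subset fun _ hp => ⟨hp.1, hp.2.1⟩

lemma card_projLine (b : Option F) : (projLine b).card = Fintype.card F := by
  rcases b with _ | c
  · have : projLine (none : Option F) = Finset.univ.image fun x : F => (x, (0 : F)) := by
      ext ⟨x, y⟩; simp [projLine, eq_comm]
    rw [this, Finset.card_image_of_injective _ fun x y h => by simpa using h, Finset.card_univ]
  · have : projLine (some c : Option F) = Finset.univ.image fun y : F => (c * y, y) := by
      ext ⟨x, y⟩; simp [projLine, eq_comm]
    rw [this, Finset.card_image_of_injective _ fun x y h => by simpa using (Prod.ext_iff.1 h).2,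
      Finset.card_univ]

lemma ncard_interpPairs {e : ℕ} {S : Finset (Option F)} (hS : S.card ≤ e + 1)
    (U : Option F → Finset (F × F)) :
    (interpPairs e S U).ncard * Fintype.card F ^ (2 * S.card) =
      Fintype.card F ^ (2 * (e + 1)) * ∏ s ∈ S, (U s).card := by
  let φ : degreeLT F (e + 1) × degreeLT F (e + 1) →+ (S → F × F) :=
    { toFun := fun p s => (projEval e s p.1, projEval e s p.2)
      map_zero' := by ext <;> simp
      map_add' := fun p q => by ext <;> simp }
  have hφ : Function.Surjective φ := by
    intro t
    obtain ⟨f, hf, hft⟩ := exists_projEval_eq hS fun s => if h : s ∈ S then (t ⟨s, h⟩).1 else 0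
    obtain ⟨g, hg, hgt⟩ := exists_projEval_eq hS fun s => if h : s ∈ S then (t ⟨s, h⟩).2 else 0
    refine ⟨(⟨f, hf⟩, ⟨g, hg⟩), ?_⟩
    ext s
    · exact (hft s s.2).trans (by simp)
    · exact (hgt s s.2).trans (by simp)
  have key := ncard_preimage_mul_card φ hφ (Fintype.piFinset fun s : S => U s : Set (S → F × F))
  have himg : interpPairs e S U = Prod.map Subtype.val Subtype.val ''
      (φ ⁻¹' (Fintype.piFinset fun s : S => U s : Set (S → F × F))) := by
    ext ⟨f, g⟩
    constructor
    · rintro ⟨hf, hg, h⟩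
      exact ⟨(⟨f, hf⟩, ⟨g, hg⟩), by simpa [φ] using h, rfl⟩
    · rintro ⟨⟨⟨f, hf⟩, ⟨g, hg⟩⟩, h, h'⟩
      obtain ⟨rfl, rfl⟩ := Prod.ext_iff.1 h'
      exact ⟨hf, hg, by simpa [φ] using h⟩
  rw [himg, Set.ncard_image_of_injective _ (Subtype.val_injective.prodMap Subtype.val_injective)]
  rw [Set.ncard_coe_finset, Fintype.card_piFinset, Nat.card_prod, card_degreeLT] at key
  rw [Finset.prod_coe_sort S fun s => (U s).card] at key
  have hH : Nat.card (S → F × F) = Fintype.card F ^ (2 * S.card) := by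
    simp [pow_mul, sq]
  rw [hH] at key
  rw [key]
  ring

lemma ncard_interpPairs_projLine {e : ℕ} {S : Finset (Option F)} (hS : S.card ≤ e + 1)
    (σ : Option F → Option F) :
    ((interpPairs e S fun s => projLine (σ s)).ncard : ℝ) =
      (Fintype.card F : ℝ) ^ (2 * e + 2) / (Fintype.card F : ℝ) ^ S.card := by
  have hq : (0 : ℝ) < Fintype.card F := by exact_mod_cast Fintype.card_pos
  have h := ncard_interpPairs hS fun s => projLine (σ s)
  simp only [card_projLine, Finset.prod_const] at h
  have h' : ((interpPairs e S fun s => projLine (σ s)).ncard : ℝ) *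
      (Fintype.card F : ℝ) ^ (2 * S.card) =
        (Fintype.card F : ℝ) ^ (2 * (e + 1)) * (Fintype.card F : ℝ) ^ S.card := by
    exact_mod_cast h
  rw [eq_div_iff (by positivity)]
  refine mul_right_cancel₀ (pow_pos hq S.card).ne' ?_
  rw [mul_assoc, ← pow_add, ← two_mul, h', mul_add, mul_one]

lemma ncard_interpPairs_projLine_le_pow {e : ℕ} {S : Finset (Option F)} (hS : e + 2 ≤ S.card)
    {σ : Option F → Option F} (hσ : Set.InjOn σ S) :
    (interpPairs e S fun s => projLine (σ s)).ncard ≤ Fintype.card F ^ e := by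
  obtain ⟨S', hS'S, hS'⟩ := Finset.exists_subset_card_eq (show e ≤ S.card by omega)
  have h2 : 1 < (S \ S').card := by rw [Finset.card_sdiff_of_subset hS'S]; omega
  obtain ⟨a, ha, b, hb, hab⟩ := Finset.one_lt_card.1 h2
  rw [Finset.mem_sdiff] at ha hb
  have hσab : σ a ≠ σ b := fun h => hab (hσ ha.1 hb.1 h)
  let T : Finset (S' → F × F) := Fintype.piFinset fun s : S' => projLine (σ s)
  have hT : (T : Set (S' → F × F)).ncard = Fintype.card F ^ e := by
    rw [Set.ncard_coe_finset, Fintype.card_piFinset]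
    simp [card_projLine, hS']
  rw [← hT]
  refine Set.ncard_le_ncard_of_injOn
    (fun p s => (projEval e s p.1, projEval e s p.2)) ?_ ?_ T.finite_toSet
  · intro p hp
    simpa [T] using fun s hs => hp.2.2 s (hS'S hs)
  · intro p hp r hr hpr
    have hline : ∀ (c : Option F) (u v : F × F), u ∈ projLine c → v ∈ projLine c →
        u - v ∈ projLine c := by
      rintro (_ | c) u v hu hv <;>
        simp only [projLine, Finset.mem_filter, Finset.mem_univ, true_and] at hu hv ⊢
      · simp [hu, hv]
      · simp only [Prod.fst_sub, Prod.snd_sub, hu, hv]; ring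
    have hS'z : ∀ s ∈ S', projEval e s p.1 = projEval e s r.1 ∧
        projEval e s p.2 = projEval e s r.2 := fun s hs =>
      Prod.ext_iff.1 (congrFun hpr ⟨s, hs⟩)
    have h := eq_zero_of_projEval_eq_zero_of_mem_projLine hS'.ge ha.2 hb.2 hσab
      (Submodule.sub_mem _ hp.1 hr.1) (Submodule.sub_mem _ hp.2.1 hr.2.1)
      (fun s hs => by rw [map_sub, (hS'z s hs).1, sub_self])
      (fun s hs => by rw [map_sub, (hS'z s hs).2, sub_self])
      (by simpa using hline _ _ _ (hp.2.2 a ha.1) (hr.2.2 a ha.1))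
      (by simpa using hline _ _ _ (hp.2.2 b hb.1) (hr.2.2 b hb.1))
    exact Prod.ext (sub_eq_zero.1 h.1) (sub_eq_zero.1 h.2)

lemma ncard_interpPairs_projLine_le {e : ℕ} {S : Finset (Option F)}
    {σ : Option F → Option F} (hσ : Set.InjOn σ S) :
    ((interpPairs e S fun s => projLine (σ s)).ncard : ℝ) ≤
      (Fintype.card F : ℝ) ^ (2 * e + 2) / (Fintype.card F : ℝ) ^ S.card +
        (Fintype.card F : ℝ) ^ e := by
  rcases le_or_gt S.card (e + 1) with h | h
  · rw [ncard_interpPairs_projLine h]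
    exact le_add_of_nonneg_right (by positivity)
  · have : ((interpPairs e S fun s => projLine (σ s)).ncard : ℝ) ≤ (Fintype.card F : ℝ) ^ e := by
      exact_mod_cast ncard_interpPairs_projLine_le_pow h hσ
    exact this.trans (le_add_of_nonneg_left (by positivity))

/-- The elements of `interpPairs` whose components both vanish at the point `a`. -/
def commonZeroPairs (e : ℕ) (S : Finset (Option F)) (σ : Option F → Option F) (a : Option F) :
    Set (F[X] × F[X]) :=
  {p ∈ interpPairs e S fun s => projLine (σ s) | projEval e a p.1 = 0 ∧ projEval e a p.2 = 0}

lemma ncard_commonZeroPairs_le {e : ℕ} {S : Finset (Option F)} (hS : S.card ≤ e)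
    (σ : Option F → Option F) (a : Option F) :
    ((commonZeroPairs e S σ a).ncard : ℝ) ≤
      (Fintype.card F : ℝ) ^ (2 * e + 2) / (Fintype.card F : ℝ) ^ S.card *
        if a ∈ S then 1 / (Fintype.card F : ℝ) else 1 / (Fintype.card F : ℝ) ^ 2 := by
  have hq : (0 : ℝ) < Fintype.card F := by exact_mod_cast Fintype.card_pos
  have hins : insert a S = insert a (S.erase a) := by
    ext s
    by_cases h : s = a <;> simp [h]
  have hcard : (S.erase a).card + 1 = (insert a S).card := by
    rw [hins]
    exact (Finset.card_insert_of_notMem (Finset.notMem_erase a S)).symm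
  have hle : (insert a S).card ≤ e + 1 := (Finset.card_insert_le a S).trans (by omega)
  let U : Option F → Finset (F × F) := Function.update (fun s => projLine (σ s)) a {0}
  have hsub : commonZeroPairs e S σ a ⊆ interpPairs e (insert a S) U := by
    rintro p ⟨⟨h1, h2, h3⟩, h4⟩
    refine ⟨h1, h2, fun s hs => ?_⟩
    by_cases hsa : s = a
    · subst hsa
      simp [U, h4.1, h4.2]
    · have hs' : s ∈ S := (Finset.mem_insert.1 hs).resolve_left hsa
      simpa [U, hsa] using h3 s hs'
  have hN := ncard_interpPairs hle U
  have hprod : ∏ s ∈ insert a S, (U s).card = Fintype.card F ^ (S.erase a).card := by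
    rw [hins, Finset.prod_insert (Finset.notMem_erase a S)]
    rw [Finset.prod_congr rfl (g := fun _ => Fintype.card F)]
    · simp [U]
    · intro s hs
      simp [U, Finset.ne_of_mem_erase hs, card_projLine]
  rw [hprod, ← hcard] at hN
  have hN' : ((interpPairs e (insert a S) U).ncard : ℝ) *
      (Fintype.card F : ℝ) ^ (2 * ((S.erase a).card + 1)) =
        (Fintype.card F : ℝ) ^ (2 * (e + 1)) * (Fintype.card F : ℝ) ^ (S.erase a).card := by
    exact_mod_cast hN
  have hle' : ((commonZeroPairs e S σ a).ncard : ℝ) ≤ (interpPairs e (insert a S) U).ncard := by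
    exact_mod_cast Set.ncard_le_ncard hsub (finite_interpPairs _ _ _)
  refine hle'.trans (le_of_eq ?_)
  have h1 : ((interpPairs e (insert a S) U).ncard : ℝ) =
      (Fintype.card F : ℝ) ^ (2 * e + 2) / (Fintype.card F : ℝ) ^ ((S.erase a).card + 2) := by
    rw [eq_div_iff (by positivity)]
    refine mul_right_cancel₀ (pow_pos hq (S.erase a).card).ne' ?_
    rw [mul_assoc, ← pow_add, show 2 * e + 2 = 2 * (e + 1) by ring, ← hN']
    ring_nf
  rw [h1]
  split_ifs with ha
  · have : S.card = (S.erase a).card + 1 := (Finset.card_erase_add_one ha).symm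
    rw [this]
    field_simp
    ring
  · rw [Finset.erase_eq_of_notMem ha]
    field_simp
    ring

lemma sum_ncard_commonZeroPairs_le {e : ℕ} {S : Finset (Option F)} (hS : S.card ≤ e)
    (σ : Option F → Option F) :
    ∑ a, ((commonZeroPairs e S σ a).ncard : ℝ) ≤
      (Fintype.card F : ℝ) ^ (2 * e + 2) / (Fintype.card F : ℝ) ^ S.card *
        (S.card / (Fintype.card F : ℝ) +
          (Fintype.card F + 1 - S.card) / (Fintype.card F : ℝ) ^ 2) := by
  refine (Finset.sum_le_sum fun a _ => ncard_commonZeroPairs_le hS σ a).trans (le_of_eq ?_)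
  rw [← Finset.mul_sum, Finset.sum_ite, Finset.sum_const, Finset.sum_const]
  have h1 : (Finset.univ.filter fun a => a ∈ S) = S := by ext; simp
  have h2 : ((Finset.univ.filter fun a => a ∉ S).card : ℝ) = Fintype.card F + 1 - S.card := by
    have : (Finset.univ.filter fun a => a ∉ S) = Sᶜ := by ext; simp
    rw [this, Finset.card_compl, Nat.cast_sub (Finset.card_le_univ S)]
    simp
  rw [h1, nsmul_eq_mul, nsmul_eq_mul, h2]
  ring

lemma ncard_monic_natDegree_le (m : ℕ) :
    {h : F[X] | h.Monic ∧ h.natDegree = m}.ncard ≤ Fintype.card F ^ m := by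
  have hfin : (degreeLT F m : Set F[X]).Finite := finite_degreeLT m
  have hc : (degreeLT F m : Set F[X]).ncard = Fintype.card F ^ m := card_degreeLT m
  rw [← hc]
  refine Set.ncard_le_ncard_of_injOn (fun h => h - X ^ m) ?_ ?_ hfin
  · rintro h ⟨h1, h2⟩
    refine mem_degreeLT.2 ?_
    have hd : h.degree = m := by rw [degree_eq_natDegree h1.ne_zero, h2]
    rw [← hd]
    exact degree_sub_lt_left (by rw [hd, degree_X_pow]) h1.ne_zero
      (by rw [h1.leadingCoeff, (monic_X_pow m).leadingCoeff])
  · intro h _ h' _ hh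
    exact sub_left_injective hh

lemma finite_monic_natDegree (m : ℕ) : {h : F[X] | h.Monic ∧ h.natDegree = m}.Finite := by
  have hfin : (degreeLT F (m + 1) : Set F[X]).Finite := finite_degreeLT (m + 1)
  refine hfin.subset fun h hh => mem_degreeLT.2 ?_
  rw [degree_eq_natDegree hh.1.ne_zero, hh.2]
  exact_mod_cast Nat.lt_succ_self m

/-- The products of a monic polynomial of degree `m` with an element of `interpPairs`. -/
def multiplePairs (m e : ℕ) (S : Finset (Option F)) (σ : Option F → Option F) :
    Set (F[X] × F[X]) :=
  (fun x : F[X] × F[X] × F[X] => (x.1 * x.2.1, x.1 * x.2.2)) ''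
    ({h : F[X] | h.Monic ∧ h.natDegree = m} ×ˢ interpPairs e S fun s => projLine (σ s))

lemma finite_multiplePairs (m e : ℕ) (S : Finset (Option F)) (σ : Option F → Option F) :
    (multiplePairs m e S σ).Finite :=
  ((finite_monic_natDegree m).prod (finite_interpPairs e S _)).image _

lemma ncard_multiplePairs_le {m d : ℕ} (hm : m ≤ d) {S : Finset (Option F)}
    {σ : Option F → Option F} (hσ : Set.InjOn σ S) :
    ((multiplePairs m (d - m) S σ).ncard : ℝ) ≤
      (Fintype.card F : ℝ) ^ (2 * d + 2) / (Fintype.card F : ℝ) ^ S.card *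
        (1 / (Fintype.card F : ℝ) ^ m) + (Fintype.card F : ℝ) ^ d := by
  have hq : (0 : ℝ) < Fintype.card F := by exact_mod_cast Fintype.card_pos
  have h1 : (multiplePairs m (d - m) S σ).ncard ≤
      Fintype.card F ^ m * (interpPairs (d - m) S fun s => projLine (σ s)).ncard := by
    refine (Set.ncard_image_le
      ((finite_monic_natDegree m).prod (finite_interpPairs (d - m) S _))).trans ?_
    rw [Set.ncard_prod]
    exact Nat.mul_le_mul_right _ (ncard_monic_natDegree_le m)
  have h2 : ((multiplePairs m (d - m) S σ).ncard : ℝ) ≤ (Fintype.card F : ℝ) ^ m *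
      ((interpPairs (d - m) S fun s => projLine (σ s)).ncard : ℝ) := by exact_mod_cast h1
  refine (h2.trans (mul_le_mul_of_nonneg_left
    (ncard_interpPairs_projLine_le hσ) (by positivity))).trans (le_of_eq ?_)
  obtain ⟨e, rfl⟩ := Nat.exists_eq_add_of_le hm
  rw [Nat.add_sub_cancel_left]
  field_simp
  ring

omit [Fintype F] in
lemma mem_degreeLT_succ_iff {n : ℕ} {f : F[X]} : f ∈ degreeLT F (n + 1) ↔ f.natDegree ≤ n := by
  rw [mem_degreeLT, degree_lt_iff_coeff_zero, natDegree_le_iff_coeff_eq_zero]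
  simp

lemma ratMap_eq_of_mem_projLine {d : ℕ} {f g : F[X]} (hf : f.natDegree ≤ d)
    (hg : g.natDegree ≤ d) {a b : Option F}
    (ha : ¬(projEval d a f = 0 ∧ projEval d a g = 0))
    (hab : (projEval d a f, projEval d a g) ∈ projLine b) : ratMap f g a = b := by
  have hdeg : ∀ {u : F[X]}, u.natDegree ≤ d → u.coeff d ≠ 0 → u.degree = d := fun hu h =>
    le_antisymm (natDegree_le_iff_degree_le.1 hu) (le_degree_of_ne_zero h)
  have hdeg' : ∀ {u : F[X]}, u.natDegree ≤ d → u.coeff d = 0 → u.degree < d := fun hu h => by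
    refine lt_of_le_of_ne (natDegree_le_iff_degree_le.1 hu) fun hd => ?_
    exact coeff_ne_zero_of_eq_degree hd h
  have hlead : ∀ {u : F[X]}, u.degree = d → u.leadingCoeff = u.coeff d := fun h => by
    rw [leadingCoeff, natDegree_eq_of_degree_eq_some h]
  rcases a with _ | a <;> rcases b with _ | b <;>
    simp only [projEval_none, projEval_some, projLine, Finset.mem_filter, Finset.mem_univ,
      true_and] at ha hab
  · have hfd : f.coeff d ≠ 0 := fun h => ha ⟨h, hab⟩
    simp [ratMap, hdeg hf hfd, hdeg' hg hab]
  · have hgd : g.coeff d ≠ 0 := fun h => ha ⟨by rw [hab, h, mul_zero], h⟩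
    by_cases hfd : f.coeff d = 0
    · have hb : b = 0 := (mul_eq_zero.1 (hab.symm.trans hfd)).resolve_right hgd
      have hlt := hdeg' hf hfd
      rw [← hdeg hg hgd] at hlt
      simp [ratMap, hlt.ne, hlt.le, hb]
    · have h1 := hdeg hf hfd
      have h2 := hdeg hg hgd
      simp only [ratMap, h1, h2, lt_irrefl, if_false, if_true, hlead h1, hlead h2, hab]
      rw [mul_div_cancel_right₀ _ hgd]
  · have hfa : f.eval a ≠ 0 := fun h => ha ⟨h, hab⟩
    simp [ratMap, hab, hfa]
  · have hga : g.eval a ≠ 0 := fun h => ha ⟨by rw [hab, h, mul_zero], h⟩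
    simp [ratMap, hab, hga]

lemma mem_projLine_of_mul_mem {b : Option F} {c x y : F} (hc : c ≠ 0)
    (h : (c * x, c * y) ∈ projLine b) : (x, y) ∈ projLine b := by
  rcases b with _ | b <;>
    simp only [projLine, Finset.mem_filter, Finset.mem_univ, true_and] at h ⊢
  · exact (mul_eq_zero.1 h).resolve_left hc
  · exact mul_left_cancel₀ hc (by rw [h]; ring)

lemma exists_mem_multiplePairs {d : ℕ} {S : Finset (Option F)}
    {σ : Option F → Option F} {p : F[X] × F[X]}
    (hp : p ∈ interpPairs d S fun s => projLine (σ s)) (hc : ¬IsCoprime p.1 p.2)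
    (hz : ∀ a, p ∉ commonZeroPairs d S σ a) :
    ∃ m ∈ Finset.Icc 2 d, p ∈ multiplePairs m (d - m) S σ := by
  obtain ⟨f, g⟩ := p
  have hz' : ∀ a, ¬(projEval d a f = 0 ∧ projEval d a g = 0) := fun a h => hz a ⟨hp, h⟩
  set h₀ := EuclideanDomain.gcd f g with hh₀
  have hne : h₀ ≠ 0 := fun h => by
    obtain ⟨rfl, rfl⟩ := EuclideanDomain.gcd_eq_zero_iff.1 h
    exact hz' none (by simp)
  have hmon : (normalize h₀).Monic := monic_normalize hne
  have hnu : ¬IsUnit (normalize h₀) := fun h => hc <| by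
    rw [← EuclideanDomain.gcd_isUnit_iff]
    exact (associated_normalize h₀).isUnit_iff.2 h
  obtain ⟨f', hf'⟩ : normalize h₀ ∣ f :=
    (normalize_associated h₀).dvd.trans (EuclideanDomain.gcd_dvd_left f g)
  obtain ⟨g', hg'⟩ : normalize h₀ ∣ g :=
    (normalize_associated h₀).dvd.trans (EuclideanDomain.gcd_dvd_right f g)
  generalize normalize h₀ = h at *
  subst hf' hg'
  have hroot : ∀ a, h.eval a ≠ 0 := fun a ha => hz' (some a) (by simp [ha])
  have hfd := mem_degreeLT_succ_iff.1 hp.1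
  have hgd := mem_degreeLT_succ_iff.1 hp.2.1
  have hdeg : ∀ u : F[X], (h * u).natDegree ≤ d → u ≠ 0 → h.natDegree + u.natDegree ≤ d :=
    fun u hu hu0 => by rwa [hmon.natDegree_mul' hu0] at hu
  have hhd : h.natDegree ≤ d := by
    by_cases hf0 : f' = 0
    · by_cases hg0 : g' = 0
      · exact absurd (by simp [hf0, hg0]) (hz' none)
      · exact (Nat.le_add_right _ _).trans (hdeg g' hgd hg0)
    · exact (Nat.le_add_right _ _).trans (hdeg f' hfd hf0)
  have hdeg' : ∀ u : F[X], (h * u).natDegree ≤ d → u.natDegree ≤ d - h.natDegree := fun u hu => by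
    by_cases hu0 : u = 0
    · simp [hu0]
    · have := hdeg u hu hu0
      omega
  have hcoeff : ∀ u : F[X], (h * u).natDegree ≤ d →
      (h * u).coeff d = u.coeff (d - h.natDegree) := fun u hu => by
    conv_lhs => rw [← Nat.add_sub_cancel' hhd]
    rw [coeff_mul_add_eq_of_natDegree_le le_rfl (hdeg' u hu), hmon.coeff_natDegree, one_mul]
  refine ⟨h.natDegree, Finset.mem_Icc.2 ⟨?_, hhd⟩, (h, f', g'), ⟨⟨hmon, rfl⟩,
    mem_degreeLT_succ_iff.2 (hdeg' f' hfd), mem_degreeLT_succ_iff.2 (hdeg' g' hgd), ?_⟩, rfl⟩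
  · by_contra hlt
    have h1 : h.natDegree ≠ 0 := fun h0 => hnu (by rw [hmon.natDegree_eq_zero.1 h0]; exact isUnit_one)
    have h2 : h.degree = 1 := by
      rw [degree_eq_natDegree hmon.ne_zero]
      exact_mod_cast (by omega : h.natDegree = 1)
    obtain ⟨a, ha⟩ := exists_root_of_degree_eq_one h2
    exact hroot a ha
  · rintro (_ | a) hs
    · have := hp.2.2 none hs
      simpa [hcoeff f' hfd, hcoeff g' hgd] using this
    · have := hp.2.2 (some a) hs
      exact mem_projLine_of_mul_mem (hroot a) (by simpa using this)

variable (F) in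
/-- The pairs of polynomials that represent rational functions of degree `d`. -/
def ratPairs (d : ℕ) : Set (F[X] × F[X]) :=
  {p | IsCoprime p.1 p.2 ∧ max p.1.natDegree p.2.natDegree = d}

lemma finite_ratPairs (d : ℕ) : (ratPairs F d).Finite := by
  have h : (degreeLT F (d + 1) : Set F[X]).Finite := finite_degreeLT (d + 1)
  exact (h.prod h).subset fun p hp => ⟨mem_degreeLT_succ_iff.2 ((le_max_left _ _).trans hp.2.le),
    mem_degreeLT_succ_iff.2 ((le_max_right _ _).trans hp.2.le)⟩

lemma ncard_ratPairs_le (d : ℕ) : (ratPairs F d).ncard ≤ Fintype.card F ^ (2 * d + 2) := by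
  have h := ncard_interpPairs (F := F) (e := d) (S := ∅) (by simp) fun _ => ∅
  simp only [Finset.card_empty, mul_zero, pow_zero, mul_one, Finset.prod_empty] at h
  rw [show 2 * d + 2 = 2 * (d + 1) by ring, ← h]
  refine Set.ncard_le_ncard (fun p hp => ?_) (finite_interpPairs _ _ _)
  exact ⟨mem_degreeLT_succ_iff.2 ((le_max_left _ _).trans hp.2.le),
    mem_degreeLT_succ_iff.2 ((le_max_right _ _).trans hp.2.le), by simp⟩

lemma interpPairs_subset (d : ℕ) (S : Finset (Option F)) (σ : Option F → Option F) :
    (interpPairs d S fun s => projLine (σ s)) ⊆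
      {p ∈ ratPairs F d | ∀ s ∈ S, ratMap p.1 p.2 s = σ s} ∪
        ((⋃ a, commonZeroPairs d S σ a) ∪
          ⋃ m : Finset.Icc 2 d, multiplePairs m (d - m) S σ) := by
  intro p hp
  by_cases hz : ∃ a, p ∈ commonZeroPairs d S σ a
  · exact Or.inr (Or.inl (Set.mem_iUnion.2 hz))
  push Not at hz
  by_cases hc : IsCoprime p.1 p.2
  · have hf := mem_degreeLT_succ_iff.1 hp.1
    have hg := mem_degreeLT_succ_iff.1 hp.2.1
    have hz' : ∀ a, ¬(projEval d a p.1 = 0 ∧ projEval d a p.2 = 0) := fun a h => hz a ⟨hp, h⟩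
    refine Or.inl ⟨⟨hc, le_antisymm (max_le hf hg) ?_⟩,
      fun s hs => ratMap_eq_of_mem_projLine hf hg (hz' s) (hp.2.2 s hs)⟩
    by_contra! hlt
    rw [max_lt_iff] at hlt
    exact hz' none ⟨coeff_eq_zero_of_natDegree_lt hlt.1, coeff_eq_zero_of_natDegree_lt hlt.2⟩
  · obtain ⟨m, hm, hpm⟩ := exists_mem_multiplePairs hp hc hz
    exact Or.inr (Or.inr (Set.mem_iUnion.2 ⟨⟨m, hm⟩, hpm⟩))

lemma sum_Icc_one_div_pow_le {x : ℝ} (hx : 2 ≤ x) {d : ℕ} (hd : 1 ≤ d) :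
    ∑ m ∈ Finset.Icc 2 d, 1 / x ^ m ≤ 1 / x := by
  have hx0 : 0 < x := by linarith
  suffices ∑ m ∈ Finset.Icc 2 d, 1 / x ^ m ≤ 1 / x - 1 / x ^ d from
    this.trans (sub_le_self _ (by positivity))
  induction d, hd using Nat.le_induction with
  | base => simp
  | succ d hd ih =>
    rw [Finset.sum_Icc_succ_top (by omega)]
    have : 2 * (1 / x ^ (d + 1)) ≤ 1 / x ^ d := by
      rw [pow_succ, mul_one_div, div_le_div_iff₀ (by positivity) (by positivity)]
      nlinarith [pow_pos hx0 d]
    linarith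

lemma mul_pow_le_mul_pow {x : ℝ} (hx : 2 ≤ x) {k d : ℕ} (hk : 1 ≤ k) (hkd : k ≤ d) :
    d * x ^ k ≤ k * x ^ d := by
  induction d, hkd using Nat.le_induction with
  | base => exact le_rfl
  | succ d hd ih =>
    have h1 : (1 : ℝ) ≤ d := by exact_mod_cast hk.trans hd
    have h2 : 0 < x ^ k := by positivity
    have h3 : 0 ≤ (k : ℝ) * x ^ d := by positivity
    push_cast
    rw [pow_succ]
    nlinarith

lemma sum_ncard_multiplePairs_le {d : ℕ} {S : Finset (Option F)} {σ : Option F → Option F}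
    (hσ : Set.InjOn σ S) (hS : 1 ≤ S.card) (hSd : S.card ≤ d) :
    ∑ m : Finset.Icc 2 d, ((multiplePairs m (d - m) S σ).ncard : ℝ) ≤
      (Fintype.card F : ℝ) ^ (2 * d + 2) / (Fintype.card F : ℝ) ^ S.card *
        (1 / (Fintype.card F : ℝ) + S.card / (Fintype.card F : ℝ) ^ 2) := by
  have hq : (2 : ℝ) ≤ Fintype.card F := by exact_mod_cast Fintype.one_lt_card
  generalize hQ : (Fintype.card F : ℝ) = Q at *
  have hQ0 : 0 < Q := by linarith
  rw [Finset.sum_coe_sort (Finset.Icc 2 d) fun m => ((multiplePairs m (d - m) S σ).ncard : ℝ)]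
  have h1 : ∑ m ∈ Finset.Icc 2 d, ((multiplePairs m (d - m) S σ).ncard : ℝ) ≤
      ∑ m ∈ Finset.Icc 2 d, (Q ^ (2 * d + 2) / Q ^ S.card * (1 / Q ^ m) + Q ^ d) := by
    refine Finset.sum_le_sum fun m hm => ?_
    rw [← hQ]
    exact ncard_multiplePairs_le (Finset.mem_Icc.1 hm).2 hσ
  refine h1.trans ?_
  rw [Finset.sum_add_distrib, ← Finset.mul_sum, mul_add, Finset.sum_const, Nat.card_Icc,
    nsmul_eq_mul]
  refine add_le_add (mul_le_mul_of_nonneg_left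
    (sum_Icc_one_div_pow_le hq (hS.trans hSd)) (by positivity)) ?_
  have h2 : ((d + 1 - 2 : ℕ) : ℝ) ≤ d := by exact_mod_cast (by omega)
  refine (mul_le_mul_of_nonneg_right h2 (by positivity)).trans ?_
  rw [div_mul_div_comm, le_div_iff₀ (by positivity)]
  have h3 := mul_le_mul_of_nonneg_left (mul_pow_le_mul_pow hq hS hSd)
    (by positivity : 0 ≤ Q ^ d * Q ^ 2)
  calc (d : ℝ) * Q ^ d * (Q ^ S.card * Q ^ 2) = Q ^ d * Q ^ 2 * (d * Q ^ S.card) := by ring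
    _ ≤ Q ^ d * Q ^ 2 * (S.card * Q ^ d) := h3
    _ = Q ^ (2 * d + 2) * S.card := by ring

/-- A lower bound for the number of pairs representing a rational function of degree `d` with
prescribed distinct values on a set of at most `d` points. -/
lemma le_ncard_ratPairs_interp {d : ℕ} {S : Finset (Option F)} {σ : Option F → Option F}
    (hσ : Set.InjOn σ S) (hS : 1 ≤ S.card) (hSd : S.card ≤ d) :
    (Fintype.card F : ℝ) ^ (2 * d + 2) / (Fintype.card F : ℝ) ^ S.card *
        (1 - (S.card + 4) / Fintype.card F) ≤
      ({p ∈ ratPairs F d | ∀ s ∈ S, ratMap p.1 p.2 s = σ s}.ncard : ℝ) := by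
  have hq : (2 : ℝ) ≤ Fintype.card F := by exact_mod_cast Fintype.one_lt_card
  have hfin := (finite_ratPairs (F := F) d).sep fun p => ∀ s ∈ S, ratMap p.1 p.2 s = σ s
  have hle : ((interpPairs d S fun s => projLine (σ s)).ncard : ℝ) ≤
      ({p ∈ ratPairs F d | ∀ s ∈ S, ratMap p.1 p.2 s = σ s}.ncard : ℝ) +
        (∑ a, ((commonZeroPairs d S σ a).ncard : ℝ) +
          ∑ m : Finset.Icc 2 d, ((multiplePairs m (d - m) S σ).ncard : ℝ)) := by
    have hz : (⋃ a, commonZeroPairs d S σ a).Finite :=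
      Set.finite_iUnion fun a => (finite_interpPairs _ _ _).sep _
    have hm : (⋃ m : Finset.Icc 2 d, multiplePairs m (d - m) S σ).Finite :=
      Set.finite_iUnion fun m => finite_multiplePairs _ _ _ _
    have := (Set.ncard_le_ncard (interpPairs_subset d S σ) (hfin.union (hz.union hm))).trans
      ((Set.ncard_union_le _ _).trans (Nat.add_le_add_left ((Set.ncard_union_le _ _).trans
        (Nat.add_le_add (Set.ncard_iUnion_le_of_fintype _)
          (Set.ncard_iUnion_le_of_fintype _))) _))
    exact_mod_cast this
  rw [ncard_interpPairs_projLine (hSd.trans (Nat.le_succ d))] at hle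
  have h1 := sum_ncard_commonZeroPairs_le hSd σ
  have h2 := sum_ncard_multiplePairs_le hσ hS hSd
  set Q : ℝ := (Fintype.card F : ℝ) with hQ
  set T := Q ^ (2 * d + 2) / Q ^ S.card with hT
  have hT0 : 0 ≤ T := by positivity
  have h3 : (1 - (S.card + 4) / Q : ℝ) ≤
      1 - (S.card / Q + (Q + 1 - S.card) / Q ^ 2) - (1 / Q + S.card / Q ^ 2) := by
    rw [← sub_nonneg]
    have : 1 - (S.card / Q + (Q + 1 - S.card) / Q ^ 2) - (1 / Q + S.card / Q ^ 2) -
        (1 - (S.card + 4) / Q : ℝ) = (2 * Q - 1) / Q ^ 2 := by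
      field_simp
      ring
    rw [this]
    exact div_nonneg (by linarith) (by positivity)
  have h4 := mul_le_mul_of_nonneg_left h3 hT0
  linarith

end Counting

section Cycles

variable {P : Type*} [Fintype P]

/-- The cycles of length `k` of `φ`, with a choice of starting point. -/
noncomputable def cycleTuples (φ : P → P) (k : ℕ) : Finset (Fin k ↪ P) :=
  Finset.univ.filter fun a => ∀ i, φ (a i) = a (finRotate k i)

lemma cycleTuples_apply_eq_iterate {φ : P → P} {n : ℕ} {a : Fin (n + 1) ↪ P}
    (ha : a ∈ cycleTuples φ (n + 1)) (i : ℕ) (hi : i < n + 1) : a ⟨i, hi⟩ = φ^[i] (a 0) := by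
  replace ha : ∀ i, φ (a i) = a (finRotate (n + 1) i) := by simpa [cycleTuples] using ha
  induction i with
  | zero => rfl
  | succ i ih =>
    have h := ha ⟨i, by omega⟩
    rw [finRotate_of_lt (by omega), ih (by omega)] at h
    rw [Function.iterate_succ_apply', h]

lemma minimalPeriod_cycleTuples {φ : P → P} {n : ℕ} {a : Fin (n + 1) ↪ P}
    (ha : a ∈ cycleTuples φ (n + 1)) : Function.minimalPeriod φ (a 0) = n + 1 := by
  have hper : Function.IsPeriodicPt φ (n + 1) (a 0) := by
    have h : φ (a (Fin.last n)) = a (finRotate (n + 1) (Fin.last n)) := by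
      have : ∀ i, φ (a i) = a (finRotate (n + 1) i) := by simpa [cycleTuples] using ha
      exact this _
    rw [finRotate_last] at h
    have h' := cycleTuples_apply_eq_iterate ha n (by omega)
    rw [Function.IsPeriodicPt, Function.IsFixedPt, Function.iterate_succ_apply', ← h']
    exact h
  have hle := hper.minimalPeriod_le (Nat.succ_pos n)
  have hpos := hper.minimalPeriod_pos (Nat.succ_pos n)
  by_contra hne
  have hlt : Function.minimalPeriod φ (a 0) < n + 1 := lt_of_le_of_ne hle hne
  have h := cycleTuples_apply_eq_iterate ha _ hlt
  rw [Function.iterate_minimalPeriod] at h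
  have := congrArg Fin.val (a.injective h)
  simp at this
  omega

lemma card_cycleTuples_le (φ : P → P) {k : ℕ} (hk : 1 ≤ k) :
    (cycleTuples φ k).card ≤
      (Finset.univ.filter fun x => Function.minimalPeriod φ x = k).card := by
  obtain ⟨n, rfl⟩ := Nat.exists_eq_add_of_le' hk
  refine Finset.card_le_card_of_injOn (fun a => a 0) ?_ ?_
  · intro a ha
    simpa using minimalPeriod_cycleTuples ha
  · intro a ha b hb hab
    ext ⟨i, hi⟩
    rw [cycleTuples_apply_eq_iterate ha, cycleTuples_apply_eq_iterate hb]
    exact congrArg _ hab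

lemma sum_card_cycleTuples_le (φ : P → P) (K : ℕ) :
    ∑ k ∈ Finset.Icc 1 K, (cycleTuples φ k).card ≤
      (Finset.univ.filter fun x => ∃ n : ℕ, 0 < n ∧ φ^[n] x = x).card := by
  refine (Finset.sum_le_sum fun k hk => card_cycleTuples_le φ (Finset.mem_Icc.1 hk).1).trans ?_
  rw [← Finset.card_biUnion]
  · refine Finset.card_le_card fun x hx => ?_
    obtain ⟨k, hk, hxk⟩ := Finset.mem_biUnion.1 hx
    have hxk' : Function.minimalPeriod φ x = k := by simpa using hxk
    have := Function.iterate_minimalPeriod (f := φ) (x := x)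
    simp only [Finset.mem_filter, Finset.mem_univ, true_and]
    exact ⟨k, (Finset.mem_Icc.1 hk).1, by rwa [hxk'] at this⟩
  · intro k _ l _ hkl
    refine Finset.disjoint_left.2 fun x hx hx' => hkl ?_
    simp only [Finset.mem_filter, Finset.mem_univ, true_and] at hx hx'
    exact hx.symm.trans hx'

end Cycles

section Average

variable {F : Type} [Field F] [Fintype F]

lemma le_ncard_ratPairs_cycle {d k : ℕ} (hk : 1 ≤ k) (hkd : k ≤ d) (a : Fin k ↪ Option F) :
    (Fintype.card F : ℝ) ^ (2 * d + 2) / (Fintype.card F : ℝ) ^ k *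
        (1 - (k + 4) / Fintype.card F) ≤
      (((finite_ratPairs (F := F) d).toFinset.filter
        fun p => a ∈ cycleTuples (ratMap p.1 p.2) k).card : ℝ) := by
  have hS : (Finset.univ.map a).card = k := by simp
  let σ : Option F → Option F := Function.extend a (fun i => a (finRotate k i)) id
  have hσa : ∀ i, σ (a i) = a (finRotate k i) := fun i => a.injective.extend_apply _ _ i
  have hσ : Set.InjOn σ (Finset.univ.map a : Finset (Option F)) := by
    intro x hx y hy hxy
    obtain ⟨i, -, rfl⟩ := Finset.mem_map.1 hx
    obtain ⟨j, -, rfl⟩ := Finset.mem_map.1 hy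
    rw [hσa, hσa] at hxy
    rw [(finRotate k).injective (a.injective hxy)]
  have h := le_ncard_ratPairs_interp hσ (hS.symm ▸ hk) (hS.symm ▸ hkd)
  rw [hS] at h
  refine h.trans (le_of_eq ?_)
  rw [← Set.ncard_coe_finset]
  congr 2
  ext p
  simp [cycleTuples, hσa]

lemma sum_le_sum_card_periodic {d K : ℕ} (hK : K ≤ d) :
    (Fintype.card F : ℝ) ^ (2 * d + 2) * ∑ k ∈ Finset.Icc 1 K,
      ((Fintype.card F + 1).descFactorial k : ℝ) / (Fintype.card F : ℝ) ^ k *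
        (1 - (k + 4) / Fintype.card F) ≤
      ∑ p ∈ (finite_ratPairs (F := F) d).toFinset,
        ((Finset.univ.filter fun x => ∃ n : ℕ, 0 < n ∧ (ratMap p.1 p.2)^[n] x = x).card : ℝ) := by
  have h1 : ∑ p ∈ (finite_ratPairs (F := F) d).toFinset,
      ∑ k ∈ Finset.Icc 1 K, ((cycleTuples (ratMap p.1 p.2) k).card : ℝ) ≤
      ∑ p ∈ (finite_ratPairs (F := F) d).toFinset,
        ((Finset.univ.filter fun x => ∃ n : ℕ, 0 < n ∧ (ratMap p.1 p.2)^[n] x = x).card : ℝ) :=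
    Finset.sum_le_sum fun p _ => by exact_mod_cast sum_card_cycleTuples_le (ratMap p.1 p.2) K
  refine le_trans ?_ h1
  rw [Finset.sum_comm, Finset.mul_sum]
  refine Finset.sum_le_sum fun k hk => ?_
  rw [Finset.mem_Icc] at hk
  have h2 : ∑ p ∈ (finite_ratPairs (F := F) d).toFinset,
      ((cycleTuples (ratMap p.1 p.2) k).card : ℝ) =
      ∑ a : Fin k ↪ Option F, (((finite_ratPairs (F := F) d).toFinset.filter
        fun p => a ∈ cycleTuples (ratMap p.1 p.2) k).card : ℝ) := by
    have := Finset.sum_card_bipartiteAbove_eq_sum_card_bipartiteBelow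
      (s := (finite_ratPairs (F := F) d).toFinset) (t := (Finset.univ : Finset (Fin k ↪ Option F)))
      fun p a => a ∈ cycleTuples (ratMap p.1 p.2) k
    simp only [Finset.bipartiteAbove, Finset.bipartiteBelow, Finset.filter_univ_mem] at this
    exact_mod_cast this
  rw [h2]
  refine le_trans (le_of_eq ?_) (Finset.sum_le_sum fun a _ =>
    le_ncard_ratPairs_cycle hk.1 (hk.2.trans hK) a)
  rw [Finset.sum_const, Finset.card_univ, Fintype.card_embedding_eq, Fintype.card_fin,
    Fintype.card_option, nsmul_eq_mul]
  ring

omit [Fintype F] in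
lemma scaleRel_of_quot_mk_eq {d : ℕ} {p₁ p₂ : {p : F[X] × F[X] //
    IsCoprime p.1 p.2 ∧ max p.1.natDegree p.2.natDegree = d}}
    (h : (Quot.mk _ p₁ : RatFn F d) = Quot.mk _ p₂) : ScaleRel p₁.1 p₂.1 := by
  have he : Equivalence fun p₁ p₂ : {p : F[X] × F[X] //
      IsCoprime p.1 p.2 ∧ max p.1.natDegree p.2.natDegree = d} => ScaleRel p₁.1 p₂.1 := by
    refine ⟨fun p => ⟨1, one_ne_zero, by simp, by simp⟩, ?_, ?_⟩
    · rintro p r ⟨c, hc, h1, h2⟩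
      exact ⟨c⁻¹, inv_ne_zero hc, by rw [h1, inv_smul_smul₀ hc], by rw [h2, inv_smul_smul₀ hc]⟩
    · rintro p r s ⟨c, hc, h1, h2⟩ ⟨c', hc', h1', h2'⟩
      exact ⟨c' * c, mul_ne_zero hc' hc, by rw [h1', h1, mul_smul], by rw [h2', h2, mul_smul]⟩
  exact he.quot_mk_eq_iff _ _ |>.1 h

instance finite_ratFn (d : ℕ) : Finite (RatFn F d) := by
  have : Finite {p : F[X] × F[X] // IsCoprime p.1 p.2 ∧ max p.1.natDegree p.2.natDegree = d} :=
    finite_ratPairs d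
  exact Quot.finite _

omit [Fintype F] in
lemma ratFn_nonempty (d : ℕ) : Nonempty (RatFn F d) :=
  ⟨Quot.mk _ ⟨(X ^ d, 1), isCoprime_one_right, by simp⟩⟩

lemma card_ratFn_mul_le (d : ℕ) :
    Nat.card (RatFn F d) * Nat.card Fˣ ≤ (ratPairs F d).ncard := by
  have hfin : Finite (ratPairs F d) := finite_ratPairs d
  rw [← Nat.card_prod, ← Nat.card_coe_set_eq]
  let out : RatFn F d → {p : F[X] × F[X] //
    IsCoprime p.1 p.2 ∧ max p.1.natDegree p.2.natDegree = d} := Quot.out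
  have hout : ∀ x : RatFn F d, Quot.mk _ (out x) = x := Quot.out_eq
  have hsc : ∀ (x : RatFn F d) (c : Fˣ),
      ((c : F) • (out x).1.1, (c : F) • (out x).1.2) ∈ ratPairs F d := by
    intro x c
    obtain ⟨⟨⟨f, g⟩, h⟩, h'⟩ := out x, (out x).2
    refine ⟨?_, ?_⟩
    · rw [smul_eq_C_mul, smul_eq_C_mul]
      have hu : IsUnit (C (c : F)) := isUnit_C.2 c.isUnit
      exact (isCoprime_mul_unit_left hu _ _).2 h'.1
    · rw [natDegree_smul _ c.ne_zero, natDegree_smul _ c.ne_zero]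
      exact h'.2
  refine Nat.card_le_card_of_injective (fun x => ⟨_, hsc x.1 x.2⟩) ?_
  rintro ⟨x, c⟩ ⟨y, c'⟩ h
  simp only [Subtype.mk.injEq, Prod.mk.injEq] at h
  have hxy : x = y := by
    rw [← hout x, ← hout y]
    refine Quot.sound ⟨(c' : F)⁻¹ * c, by simp, ?_, ?_⟩
    · rw [mul_smul, h.1, inv_smul_smul₀ c'.ne_zero]
    · rw [mul_smul, h.2, inv_smul_smul₀ c'.ne_zero]
  subst hxy
  have hcc : (c : F) = c' := by
    by_cases h1 : (out x).1.1 = 0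
    · have h2 : (out x).1.2 ≠ 0 := fun h2 => by
        have := (out x).2.1
        rw [h1, h2] at this
        exact not_isCoprime_zero_zero this
      exact smul_left_injective F h2 h.2
    · exact smul_left_injective F h1 h.1
  rw [Units.ext hcc]

lemma sum_card_periodic_le (d : ℕ) :
    ∑ p ∈ (finite_ratPairs (F := F) d).toFinset,
        (Finset.univ.filter fun x => ∃ n : ℕ, 0 < n ∧ (ratMap p.1 p.2)^[n] x = x).card ≤
      Nat.card {x : RatFn F d × Option F //
          ∃ p, Quot.mk _ p = x.1 ∧ ∃ n : ℕ, 0 < n ∧ (ratMap p.1.1 p.1.2)^[n] x.2 = x.2} *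
        Nat.card Fˣ := by
  let T := (finite_ratPairs (F := F) d).toFinset.sigma fun p =>
    Finset.univ.filter fun x => ∃ n : ℕ, 0 < n ∧ (ratMap p.1 p.2)^[n] x = x
  have hT : ∀ y : T, y.1.1 ∈ ratPairs F d ∧
      ∃ n : ℕ, 0 < n ∧ (ratMap y.1.1.1 y.1.1.2)^[n] y.1.2 = y.1.2 := fun y => by
    have hy := Finset.mem_sigma.1 y.2
    exact ⟨(Set.Finite.mem_toFinset _).1 hy.1, (Finset.mem_filter.1 hy.2).2⟩
  let cls : T → RatFn F d := fun y => Quot.mk _ ⟨y.1.1, (hT y).1⟩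
  let out : RatFn F d → {p : F[X] × F[X] //
    IsCoprime p.1 p.2 ∧ max p.1.natDegree p.2.natDegree = d} := Quot.out
  have hout : ∀ x : RatFn F d, Quot.mk _ (out x) = x := Quot.out_eq
  have hsc : ∀ y : T, ScaleRel (out (cls y)).1 y.1.1 := fun y =>
    scaleRel_of_quot_mk_eq (p₂ := ⟨y.1.1, (hT y).1⟩) (hout (cls y))
  choose c hc h1 h2 using hsc
  rw [← Finset.card_sigma, ← Nat.card_prod]
  change T.card ≤ _
  rw [← Nat.card_eq_finsetCard T]
  refine Nat.card_le_card_of_injective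
    (fun y => (⟨(cls y, y.1.2), ⟨⟨y.1.1, (hT y).1⟩, rfl, (hT y).2⟩⟩, Units.mk0 (c y) (hc y))) ?_
  intro y z hyz
  simp only [Prod.mk.injEq, Subtype.mk.injEq] at hyz
  obtain ⟨⟨hcls, hx⟩, hu⟩ := hyz
  have hcc : c y = c z := by simpa using congrArg Units.val hu
  refine Subtype.ext (Sigma.ext (Prod.ext ?_ ?_) (heq_of_eq hx))
  · rw [h1, h1, hcls, hcc]
  · rw [h2, h2, hcls, hcc]

lemma le_average_periodic {d K : ℕ} (hK : K ≤ d) :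
    ∑ k ∈ Finset.Icc 1 K,
      ((Fintype.card F + 1).descFactorial k : ℝ) / (Fintype.card F : ℝ) ^ k *
        (1 - (k + 4) / Fintype.card F) ≤
      (Nat.card {x : RatFn F d × Option F //
          ∃ p, Quot.mk _ p = x.1 ∧ ∃ n : ℕ, 0 < n ∧ (ratMap p.1.1 p.1.2)^[n] x.2 = x.2} : ℝ) /
        (Nat.card (RatFn F d) : ℝ) := by
  have h1 := sum_le_sum_card_periodic (F := F) hK
  have h2 := sum_card_periodic_le (F := F) d
  have h3 := (card_ratFn_mul_le (F := F) d).trans (ncard_ratPairs_le d)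
  have hne := ratFn_nonempty (F := F) d
  have hR : (0 : ℝ) < Nat.card (RatFn F d) := by exact_mod_cast Nat.card_pos
  have hU : (0 : ℝ) < Nat.card Fˣ := by exact_mod_cast Nat.card_pos
  generalize Nat.card {x : RatFn F d × Option F //
    ∃ p, Quot.mk _ p = x.1 ∧ ∃ n : ℕ, 0 < n ∧ (ratMap p.1.1 p.1.2)^[n] x.2 = x.2} = N at *
  generalize ∑ k ∈ Finset.Icc 1 K,
      ((Fintype.card F + 1).descFactorial k : ℝ) / (Fintype.card F : ℝ) ^ k *
        (1 - (k + 4) / Fintype.card F) = s at *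
  rcases le_or_gt s 0 with hs | hs
  · exact hs.trans (by positivity)
  rw [le_div_iff₀ hR]
  have h2' : (Fintype.card F : ℝ) ^ (2 * d + 2) * s ≤ N * Nat.card Fˣ :=
    h1.trans (by exact_mod_cast h2)
  have h3' : (Nat.card (RatFn F d) : ℝ) * Nat.card Fˣ ≤ (Fintype.card F : ℝ) ^ (2 * d + 2) := by
    exact_mod_cast h3
  refine le_of_mul_le_mul_right ?_ hU
  calc s * Nat.card (RatFn F d) * Nat.card Fˣ = Nat.card (RatFn F d) * Nat.card Fˣ * s := by ring
    _ ≤ (Fintype.card F : ℝ) ^ (2 * d + 2) * s := mul_le_mul_of_nonneg_right h3' hs.le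
    _ ≤ _ := h2'

end Average

lemma one_sub_le_prod_div_pow {q : ℝ} (hq : 0 < q) {k : ℕ} (hk : 1 ≤ k) (hkq : k ≤ q) :
    1 - (k - 1) * (k - 2) / (2 * q) ≤ (∏ j ∈ Finset.range k, (q + 1 - j)) / q ^ k := by
  induction k, hk using Nat.le_induction with
  | base =>
    rw [le_div_iff₀ (by positivity)]
    simp
  | succ k hk ih =>
    push_cast at hkq ⊢
    have hih := ih (by linarith)
    have h1 : (1 : ℝ) ≤ k := by exact_mod_cast hk
    have h2 : 0 ≤ 1 - (k - 1) / q := by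
      rw [sub_nonneg, div_le_one hq]
      linarith
    have h3 : (∏ j ∈ Finset.range (k + 1), (q + 1 - j)) / q ^ (k + 1) =
        (∏ j ∈ Finset.range k, (q + 1 - j)) / q ^ k * (1 - (k - 1) / q) := by
      rw [Finset.prod_range_succ]
      field_simp
      ring
    have h5 : 0 ≤ ((k : ℝ) - 1) * (k - 2) := by
      rcases hk.eq_or_lt with h | h
      · simp [← h]
      · have : (2 : ℝ) ≤ k := by exact_mod_cast h
        exact mul_nonneg (by linarith) (by linarith)
    have h6 : 0 ≤ (k - 1) * (k - 2) / (2 * q) * ((k - 1) / q) :=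
      mul_nonneg (div_nonneg h5 (by positivity)) (div_nonneg (by linarith) hq.le)
    rw [h3]
    refine le_trans ?_ (mul_le_mul_of_nonneg_right hih h2)
    have h7 : ((k : ℝ) + 1 - 1) * (k + 1 - 2) / (2 * q) =
        (k - 1) * (k - 2) / (2 * q) + (k - 1) / q := by
      field_simp
      ring
    rw [h7]
    linarith

lemma five_sixths_mul_sub_three_le_sum {q : ℝ} {n : ℕ} (hn : 4 ≤ n) (hnq : (n : ℝ) ^ 2 ≤ q) :
    5 / 6 * (n : ℝ) - 3 ≤ ∑ k ∈ Finset.Icc 1 n,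
      (∏ j ∈ Finset.range k, (q + 1 - j)) / q ^ k * (1 - (k + 4) / q) := by
  have hn' : (4 : ℝ) ≤ n := by exact_mod_cast hn
  have hq : 0 < q := by nlinarith
  have hterm : ∀ k ∈ Finset.Icc 1 n, 1 - ((k : ℝ) ^ 2 - k + 10) / (2 * q) ≤
      (∏ j ∈ Finset.range k, (q + 1 - j)) / q ^ k * (1 - (k + 4) / q) := by
    intro k hk
    rw [Finset.mem_Icc] at hk
    have hk1 : (1 : ℝ) ≤ k := by exact_mod_cast hk.1
    have hkn : (k : ℝ) ≤ n := by exact_mod_cast hk.2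
    have hb : 0 ≤ 1 - (k + 4) / q := by
      rw [sub_nonneg, div_le_one hq]
      nlinarith
    refine le_trans ?_ (mul_le_mul_of_nonneg_right
      (one_sub_le_prod_div_pow hq hk.1 (by nlinarith)) hb)
    have h5 : 0 ≤ ((k : ℝ) - 1) * (k - 2) := by
      rcases hk.1.eq_or_lt with h | h
      · simp [← h]
      · have : (2 : ℝ) ≤ k := by exact_mod_cast h
        exact mul_nonneg (by linarith) (by linarith)
    have h6 : 0 ≤ (k - 1) * (k - 2) / (2 * q) * ((k + 4) / q) :=
      mul_nonneg (div_nonneg h5 (by positivity)) (by positivity)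
    have h7 : ((k : ℝ) ^ 2 - k + 10) / (2 * q) = (k - 1) * (k - 2) / (2 * q) + (k + 4) / q := by
      field_simp
      ring
    rw [h7]
    linarith
  have hsum : ∀ m : ℕ, ∑ k ∈ Finset.Icc 1 m, (1 - ((k : ℝ) ^ 2 - k + 10) / (2 * q)) =
      m - ((m : ℝ) ^ 3 + 29 * m) / (6 * q) := by
    intro m
    induction m with
    | zero => simp
    | succ m ih =>
      rw [Finset.sum_Icc_succ_top (by omega), ih]
      push_cast
      field_simp
      ring
  refine le_trans ?_ (Finset.sum_le_sum hterm)
  rw [hsum]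
  have : ((n : ℝ) ^ 3 + 29 * n) / (6 * q) ≤ n / 6 + 3 := by
    rw [div_le_iff₀ (by positivity)]
    nlinarith
  linarith

end RatFnCount

/-- **Corollary 3.8.** The average number of periodic points in `P¹(F_q)` of a rational function
on `P¹(F_q)` of degree exactly `d` (the number of pairs `(φ, α)` with `α` periodic for `φ`,
divided by the number of such `φ`) is at least
`Σ_{k=1}^{min{d,q}} ((q+1)q⋯(q+1-(k-1))/q^k)(1 - (k+4)/q)`; in particular it is at least
`(5/6)⬝min{d,⌊√q⌋} - 3`. -/
theorem avg_periodic_points_of_rational_functions_lower_bound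
    (q d : ℕ) (F : Type) [Field F] [Fintype F] (hF : Fintype.card F = q)
    (hd : 0 < d)
    (A : ℝ)
    (hA : A = (Nat.card {x : RatFn F d × Option F //
          ∃ p, Quot.mk _ p = x.1 ∧ ∃ n : ℕ, 0 < n ∧ (ratMap p.1.1 p.1.2)^[n] x.2 = x.2} : ℝ) /
        (Nat.card (RatFn F d) : ℝ)) :
    A ≥ ∑ k ∈ Finset.Icc 1 (min d q),
        (∏ j ∈ Finset.range k, ((q : ℝ) + 1 - j)) / (q : ℝ) ^ k * (1 - (k + 4) / q) ∧
    A ≥ 5 / 6 * min d (Nat.sqrt q) - 3 := by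
  have key : ∀ K ≤ d, ∑ k ∈ Finset.Icc 1 K,
      (∏ j ∈ Finset.range k, ((q : ℝ) + 1 - j)) / (q : ℝ) ^ k * (1 - (k + 4) / q) ≤ A := by
    intro K hK
    rw [hA]
    refine le_trans (le_of_eq (Finset.sum_congr rfl fun k _ => ?_))
      (RatFnCount.le_average_periodic hK)
    rw [hF, ← descPochhammer_eval_eq_descFactorial, descPochhammer_eval_eq_prod_range]
    push_cast
    rfl
  refine ⟨key _ (min_le_left d q), ?_⟩
  rcases le_or_gt 4 (min d (Nat.sqrt q)) with hn | hn
  · refine le_trans ?_ (key _ (min_le_left d (Nat.sqrt q)))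
    have hsq : (min d (Nat.sqrt q)) ^ 2 ≤ q :=
      (Nat.pow_le_pow_left (min_le_right _ _) 2).trans (Nat.sqrt_le' q)
    have := RatFnCount.five_sixths_mul_sub_three_le_sum (q := q) hn (by exact_mod_cast hsq)
    exact_mod_cast this
  · have hA0 : 0 ≤ A := by
      rw [hA]
      positivity
    have hn' : (min d (Nat.sqrt q) : ℝ) ≤ 3 := by exact_mod_cast Nat.lt_succ_iff.1 hn
    push_cast
    linarith
end
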